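/- The time-independent Gross–Pitaevskii equation u''(x) + (a − b·cos(2x))·u(x) − c·u(x)³ = 0 with parameters a = 1.1025, b = 0.55125, c = −0.826875 has a soliton solution u : ℝ → ℝ that is even and not identically zero. -/

import Mathlib

open Filter Real

namespace GrossPitaevskii

open Set Metric Topology
open scoped NNReal

section Flow

variable {E : Type*} [NormedAddCommGroup E] [NormedSpace ℝ E] [CompleteSpace E]

/-- A bounded, globally Lipschitz, time-continuous vector field has global integral curves. -/
theorem exists_global_solution {f : ℝ → E → E} {K L : ℝ≥0}
    (hK : ∀ t, LipschitzWith K (f t)) (hc : ∀ z, Continuous fun t => f t z)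
    (hL : ∀ t z, ‖f t z‖ ≤ L) (z₀ : E) :
    ∃ γ : ℝ → E, γ 0 = z₀ ∧ ∀ t, HasDerivAt γ (f t (γ t)) t := by
  have key : ∀ n : ℕ, ∃ γ : ℝ → E, γ 0 = z₀ ∧
      ∀ t ∈ Ioo (-(n + 1 : ℝ)) (n + 1), HasDerivAt γ (f t (γ t)) t := by
    intro n
    have h0 : (0 : ℝ) ∈ Icc (-(n + 1 : ℝ)) (n + 1) := by constructor <;> linarith [n.cast_nonneg (α := ℝ)]
    have hp : IsPicardLindelof f (⟨0, h0⟩ : Icc (-(n + 1 : ℝ)) (n + 1)) z₀ (L * (n + 1)) 0 L K := by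
      refine ⟨fun t _ => (hK t).lipschitzOnWith, fun z _ => (hc z).continuousOn,
        fun t _ z _ => hL t z, ?_⟩
      simp
    obtain ⟨γ, h1, h2⟩ := hp.exists_eq_forall_mem_Icc_hasDerivWithinAt₀
    exact ⟨γ, h1, fun t ht => (h2 t (Ioo_subset_Icc_self ht)).hasDerivAt (Icc_mem_nhds ht.1 ht.2)⟩
  choose γ h0 hγ using key
  have hagree : ∀ m n : ℕ, m ≤ n → ∀ t ∈ Ioo (-(m + 1 : ℝ)) (m + 1), γ m t = γ n t := by
    intro m n hmn t ht
    have hmn' : (m : ℝ) ≤ n := by exact_mod_cast hmn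
    refine ODE_solution_unique_of_mem_Ioo (s := fun _ => univ) (K := K) (v := f) (t₀ := 0)
      (fun t _ => (hK t).lipschitzOnWith) ?_ (fun t ht => ⟨hγ m t ht, trivial⟩)
      (fun t ht => ⟨hγ n t ⟨by linarith [ht.1], by linarith [ht.2]⟩, trivial⟩)
      (by rw [h0, h0]) ht
    constructor <;> linarith [m.cast_nonneg (α := ℝ)]
  have hmem : ∀ t : ℝ, t ∈ Ioo (-((⌈|t|⌉₊ : ℕ) + 1 : ℝ)) ((⌈|t|⌉₊ : ℕ) + 1) := by
    intro t
    have := Nat.le_ceil |t|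
    constructor <;> linarith [neg_abs_le t, le_abs_self t]
  refine ⟨fun t => γ ⌈|t|⌉₊ t, by simpa using h0 0, fun t => ?_⟩
  set n := ⌈|t|⌉₊ + 1 with hn
  have ht : t ∈ Ioo (-(n : ℝ)) n := by
    have := hmem t
    rw [hn]; push_cast; exact this
  have hloc : (fun t => γ ⌈|t|⌉₊ t) =ᶠ[𝓝 t] γ n := by
    filter_upwards [Ioo_mem_nhds ht.1 ht.2] with x hx
    refine hagree _ _ ?_ x (hmem x)
    exact Nat.ceil_le.2 (abs_le.2 ⟨hx.1.le, hx.2.le⟩)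
  have h2 := hγ n t ⟨by linarith [ht.1], by linarith [ht.2]⟩
  have h3 := h2.congr_of_eventuallyEq hloc
  rwa [← hloc.eq_of_nhds] at h3

end Flow

/-- Truncation of a real number to `[-2, 2]`. -/
noncomputable def clip (x : ℝ) : ℝ := max (-2) (min x 2)

theorem clip_of_abs_le {x : ℝ} (h : |x| ≤ 2) : clip x = x := by
  have := abs_le.1 h
  rw [clip, min_eq_left this.2, max_eq_right this.1]

theorem abs_clip_le (x : ℝ) : |clip x| ≤ 2 := by
  unfold clip
  exact abs_le.2 ⟨le_max_left _ _, max_le (by norm_num) (min_le_right _ _)⟩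

theorem clip_neg (x : ℝ) : clip (-x) = -clip x := by
  unfold clip
  rcases le_total x 2 with h | h <;> rcases le_total (-2) x with h' | h' <;>
    grind

theorem abs_clip_sub_clip_le (x y : ℝ) : |clip x - clip y| ≤ |x - y| := by
  unfold clip
  grind

/-- The Gross–Pitaevskii vector field in phase space, truncated outside `[-2, 2]²`. -/
noncomputable def field (t : ℝ) (z : ℝ × ℝ) : ℝ × ℝ :=
  (clip z.2, -(1.1025 * ((1 - cos (2 * t) / 2) * clip z.1 + 3 / 4 * clip z.1 ^ 3)))

theorem field_lipschitz (t : ℝ) : LipschitzWith 12 (field t) := by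
  refine LipschitzWith.of_dist_le_mul fun z w => ?_
  have h1 : |z.1 - w.1| ≤ dist z w := by
    rw [← Real.dist_eq, Prod.dist_eq]; exact le_max_left _ _
  have h2 : |z.2 - w.2| ≤ dist z w := by
    rw [← Real.dist_eq, Prod.dist_eq]; exact le_max_right _ _
  have hc1 := abs_clip_sub_clip_le z.1 w.1
  have hc2 := abs_clip_sub_clip_le z.2 w.2
  rw [Prod.dist_eq]
  refine max_le ?_ ?_
  · simp only [field, Real.dist_eq]
    push_cast
    linarith [abs_nonneg (z.1 - w.1), abs_nonneg (z.2 - w.2)]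
  · simp only [field, Real.dist_eq]
    push_cast
    have hz := abs_le.1 (abs_clip_le z.1)
    have hw := abs_le.1 (abs_clip_le w.1)
    set a := clip z.1
    set b := clip w.1
    have hfac : -(1.1025 * ((1 - cos (2 * t) / 2) * a + 3 / 4 * a ^ 3)) -
        -(1.1025 * ((1 - cos (2 * t) / 2) * b + 3 / 4 * b ^ 3)) =
        -(1.1025 * ((1 - cos (2 * t) / 2) + 3 / 4 * (a ^ 2 + a * b + b ^ 2))) * (a - b) := by ring
    rw [hfac, abs_mul]
    have hcos := abs_le.1 (abs_cos_le_one (2 * t))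
    have hA : |(-(1.1025 * ((1 - cos (2 * t) / 2) + 3 / 4 * (a ^ 2 + a * b + b ^ 2))))| ≤ 12 := by
      have h3 : 0 ≤ a ^ 2 + a * b + b ^ 2 := by nlinarith [sq_nonneg (a + b), sq_nonneg a, sq_nonneg b]
      have h4 : a ^ 2 + a * b + b ^ 2 ≤ 12 := by nlinarith
      rw [abs_le]; constructor <;> linarith
    calc _ ≤ 12 * |a - b| := mul_le_mul_of_nonneg_right hA (abs_nonneg _)
      _ ≤ _ := by linarith

theorem norm_field_le (t : ℝ) (z : ℝ × ℝ) : ‖field t z‖ ≤ (10 : ℝ≥0) := by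
  rw [Prod.norm_def]
  have hz := abs_clip_le z.1
  have hz' := abs_clip_le z.2
  refine max_le ?_ ?_
  · simp only [field, Real.norm_eq_abs]; push_cast; linarith
  · simp only [field, Real.norm_eq_abs]; push_cast
    set a := clip z.1
    have hcos := abs_le.1 (abs_cos_le_one (2 * t))
    have h1 : |1 - cos (2 * t) / 2| ≤ 3 / 2 := by rw [abs_le]; constructor <;> linarith
    have h2 : |(1 - cos (2 * t) / 2) * a| ≤ 3 := by
      rw [abs_mul]; nlinarith [abs_nonneg a, abs_nonneg (1 - cos (2 * t) / 2)]
    have h3 : |a ^ 3| ≤ 8 := by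
      rw [abs_pow]
      calc |a| ^ 3 ≤ 2 ^ 3 := by gcongr
        _ = 8 := by norm_num
    rw [abs_le] at *
    constructor <;> linarith

/-- The trajectory of the truncated field starting from `(s, 0)`. -/
noncomputable def traj (s : ℝ) : ℝ → ℝ × ℝ :=
  (exists_global_solution field_lipschitz (fun z => by unfold field; fun_prop)
    norm_field_le (s, 0)).choose

theorem traj_zero (s : ℝ) : traj s 0 = (s, 0) :=
  (exists_global_solution field_lipschitz (fun z => by unfold field; fun_prop)
    norm_field_le (s, 0)).choose_spec.1

theorem hasDerivAt_traj (s t : ℝ) : HasDerivAt (traj s) (field t (traj s t)) t :=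
  (exists_global_solution field_lipschitz (fun z => by unfold field; fun_prop)
    norm_field_le (s, 0)).choose_spec.2 t

theorem continuous_traj (s : ℝ) : Continuous (traj s) :=
  continuous_iff_continuousAt.2 fun t => (hasDerivAt_traj s t).continuousAt

theorem dist_traj_le (s s' : ℝ) {t : ℝ} (ht : 0 ≤ t) :
    dist (traj s t) (traj s' t) ≤ |s - s'| * exp (12 * t) := by
  have h := dist_le_of_trajectories_ODE (v := field) (K := 12) (δ := |s - s'|) (a := 0) (b := t)
    field_lipschitz (continuous_traj s).continuousOn
    (fun t _ => (hasDerivAt_traj s t).hasDerivWithinAt) (continuous_traj s').continuousOn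
    (fun t _ => (hasDerivAt_traj s' t).hasDerivWithinAt)
    (by rw [traj_zero, traj_zero, Prod.dist_eq]; simp [Real.dist_eq]) t ⟨ht, le_rfl⟩
  simpa using h

theorem continuousAt_traj_uncurry (s : ℝ) {t : ℝ} (ht : 0 < t) :
    ContinuousAt (fun z : ℝ × ℝ => traj z.1 z.2) (s, t) := by
  rw [ContinuousAt, tendsto_iff_dist_tendsto_zero]
  have hb : ∀ᶠ z : ℝ × ℝ in 𝓝 (s, t), dist (traj z.1 z.2) (traj s t) ≤
      |z.1 - s| * exp (12 * z.2) + dist (traj s z.2) (traj s t) := by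
    have : ∀ᶠ z : ℝ × ℝ in 𝓝 (s, t), 0 < z.2 :=
      (continuous_snd.tendsto (s, t)).eventually (lt_mem_nhds ht)
    filter_upwards [this] with z hz
    exact (dist_triangle _ (traj s z.2) _).trans (by gcongr; exact dist_traj_le _ _ hz.le)
  refine squeeze_zero' (Eventually.of_forall fun _ => dist_nonneg) hb ?_
  have hc : Continuous fun z : ℝ × ℝ =>
      |z.1 - s| * exp (12 * z.2) + dist (traj s z.2) (traj s t) := by
    have := continuous_traj s
    fun_prop
  have := hc.tendsto (s, t)
  simpa using this

theorem traj_unique {γ : ℝ → ℝ × ℝ} (hγ : ∀ t, HasDerivAt γ (field t (γ t)) t) {s t₀ : ℝ}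
    (h : γ t₀ = traj s t₀) : γ = traj s :=
  ODE_solution_unique_univ (s := fun _ => univ) (K := 12) (v := field)
    (fun t => (field_lipschitz t).lipschitzOnWith) (fun t => ⟨hγ t, trivial⟩)
    (fun t => ⟨hasDerivAt_traj s t, trivial⟩) h

theorem hasDerivAt_traj_fst (s t : ℝ) :
    HasDerivAt (fun t => (traj s t).1) (clip (traj s t).2) t :=
  (hasFDerivAt_fst (𝕜 := ℝ) (p := traj s t)).comp_hasDerivAt t (hasDerivAt_traj s t)

theorem hasDerivAt_traj_snd (s t : ℝ) :
    HasDerivAt (fun t => (traj s t).2)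
      (-(1.1025 * ((1 - cos (2 * t) / 2) * clip (traj s t).1 + 3 / 4 * clip (traj s t).1 ^ 3))) t :=
  (hasFDerivAt_snd (𝕜 := ℝ) (p := traj s t)).comp_hasDerivAt t (hasDerivAt_traj s t)

theorem traj_neg (s t : ℝ) : traj s (-t) = ((traj s t).1, -(traj s t).2) := by
  have h : (fun t => ((traj s (-t)).1, -(traj s (-t)).2)) = traj s := by
    refine traj_unique (t₀ := 0) (fun t => ?_) (by simp [traj_zero])
    have h2 := (hasDerivAt_traj_fst s (-t)).scomp t (hasDerivAt_neg t)
    have h3 := ((hasDerivAt_traj_snd s (-t)).scomp t (hasDerivAt_neg t)).neg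
    convert! h2.prodMk h3 using 1
    simp [field, clip_neg]
  have := congrFun h t
  rw [← this]
  simp

theorem traj_ne_zero {s : ℝ} (hs : s ≠ 0) (t : ℝ) : traj s t ≠ 0 := by
  intro h
  have h0 : (fun _ : ℝ => (0 : ℝ × ℝ)) = traj s :=
    traj_unique (t₀ := t) (fun t => by
      have : field t 0 = 0 := by simp [field, clip]
      rw [this]; exact hasDerivAt_const _ _) h.symm
  have := congrFun h0 0
  rw [traj_zero] at this
  exact hs (congrArg Prod.fst this).symm

/-- The growth rate of the energy distance `d ^ 2 + ω ^ 2 * e ^ 2 = M ^ 2`, where `d' = δ`. -/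
theorem energy_growth_lt {d e δ A v r q κ ω M m₀ m₁ E g V ρ η : ℝ}
    (hκ : 0 ≤ κ) (hω : 0 < ω) (hM : 0 < M) (hE : M ≤ ω * E)
    (hN : d ^ 2 + ω ^ 2 * e ^ 2 = M ^ 2)
    (hδ : δ = -(A * e) - ω ^ 2 * e - κ * (9 / 4 * v * e ^ 2 + 3 / 4 * e ^ 3) - r + q)
    (hA : |A| ≤ g) (hv : |v| ≤ V) (hr : |r| ≤ ρ) (hq : |q| ≤ η)
    (hstep : E * g + 2 * (κ * (9 / 4 * V * E ^ 2 + 3 / 4 * E ^ 3) + ρ + η) < m₁ - m₀) :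
    2 * d * δ + ω ^ 2 * (2 * e * d) < M * (m₁ - m₀) := by
  have hEpos : 0 < E := by
    by_contra h
    nlinarith
  have hdM : |d| ≤ M := abs_le_of_sq_le_sq (by nlinarith [sq_nonneg (ω * e)]) hM.le
  have hωe : ω * |e| ≤ M := by
    have h1 : |ω * e| ≤ M := abs_le_of_sq_le_sq (by nlinarith [sq_nonneg d]) hM.le
    rwa [abs_mul, abs_of_pos hω] at h1
  have heE : |e| ≤ E := le_of_mul_le_mul_left (hωe.trans hE) hω
  have hexp : 2 * d * δ + ω ^ 2 * (2 * e * d) =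
      -(2 * d * e * A) + 2 * d * (-κ * (9 / 4 * v * e ^ 2 + 3 / 4 * e ^ 3) - r + q) := by
    rw [hδ]; ring
  rw [hexp]
  have hde : |2 * d * e| ≤ M * E := by
    have h1 : 2 * |d| * (ω * |e|) ≤ M ^ 2 := by
      rw [← hN, ← sq_abs d, ← sq_abs e]
      nlinarith [sq_nonneg (|d| - ω * |e|)]
    rw [abs_mul, abs_mul, abs_two]
    have h2 : ω * (2 * |d| * |e|) ≤ ω * (M * E) := by nlinarith
    exact le_of_mul_le_mul_left h2 hω
  have h1 : -(2 * d * e * A) ≤ M * E * g := by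
    calc -(2 * d * e * A) ≤ |2 * d * e * A| := neg_le_abs _
      _ = |2 * d * e| * |A| := abs_mul _ _
      _ ≤ M * E * g := mul_le_mul hde hA (abs_nonneg _) (by positivity)
  have hV0 : 0 ≤ V := (abs_nonneg _).trans hv
  have h2 : |-κ * (9 / 4 * v * e ^ 2 + 3 / 4 * e ^ 3) - r + q| ≤
      κ * (9 / 4 * V * E ^ 2 + 3 / 4 * E ^ 3) + ρ + η := by
    have h3 : |9 / 4 * v * e ^ 2 + 3 / 4 * e ^ 3| ≤ 9 / 4 * V * E ^ 2 + 3 / 4 * E ^ 3 := by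
      refine (abs_add_le _ _).trans ?_
      simp only [abs_mul, abs_pow]
      rw [abs_of_pos (by norm_num : (0:ℝ) < 9 / 4), abs_of_pos (by norm_num : (0:ℝ) < 3 / 4)]
      gcongr
    have h4 : |-κ * (9 / 4 * v * e ^ 2 + 3 / 4 * e ^ 3)| ≤
        κ * (9 / 4 * V * E ^ 2 + 3 / 4 * E ^ 3) := by
      rw [abs_mul, abs_neg, abs_of_nonneg hκ]; gcongr
    have h5 := abs_add_le (-κ * (9 / 4 * v * e ^ 2 + 3 / 4 * e ^ 3) - r) q
    have h6 := abs_sub (-κ * (9 / 4 * v * e ^ 2 + 3 / 4 * e ^ 3)) r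
    linarith
  have h3 : 2 * d * (-κ * (9 / 4 * v * e ^ 2 + 3 / 4 * e ^ 3) - r + q) ≤
      2 * M * (κ * (9 / 4 * V * E ^ 2 + 3 / 4 * E ^ 3) + ρ + η) := by
    calc _ ≤ |2 * d * (-κ * (9 / 4 * v * e ^ 2 + 3 / 4 * e ^ 3) - r + q)| := le_abs_self _
      _ = 2 * |d| * |-κ * (9 / 4 * v * e ^ 2 + 3 / 4 * e ^ 3) - r + q| := by
        rw [abs_mul, abs_mul, abs_two]
      _ ≤ _ := mul_le_mul (by linarith) h2 (abs_nonneg _) (by positivity)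
  have h4 := mul_lt_mul_of_pos_left hstep hM
  linarith

theorem abs_le_of_energy_le {U P v dv ω M E V : ℝ} (hω : 0 < ω) (hM : 0 ≤ M) (hE : M ≤ ω * E)
    (hV : |v| ≤ V) (hdV : |dv| + M ≤ 3 / 4) (hVE : V + E ≤ 3 / 2)
    (h : (P - dv) ^ 2 + ω ^ 2 * (U - v) ^ 2 ≤ M ^ 2) : |U| ≤ 3 / 2 ∧ |P| ≤ 3 / 4 := by
  have hdM : |P - dv| ≤ M := abs_le_of_sq_le_sq (by nlinarith [sq_nonneg (ω * (U - v))]) hM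
  have hωe : ω * |U - v| ≤ M := by
    have h1 : |ω * (U - v)| ≤ M := abs_le_of_sq_le_sq (by nlinarith [sq_nonneg (P - dv)]) hM
    rwa [abs_mul, abs_of_pos hω] at h1
  have heE : |U - v| ≤ E := le_of_mul_le_mul_left (hωe.trans hE) hω
  have hU := abs_add_le v (U - v)
  have hP := abs_add_le dv (P - dv)
  rw [add_sub_cancel] at hU hP
  constructor <;> linarith

/-- One step of the a posteriori error estimate: the energy distance between a trajectory `(U, P)`
and an approximate solution `v` grows from at most `m₀` to at most `m₁` across `[-1, 1]`. -/
theorem energy_step {U U' P P' v dv ddv C : ℝ → ℝ} {κ ω m₀ m₁ E g V ρ η : ℝ}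
    (hκ : 0 ≤ κ) (hω : 0 < ω) (hm₀ : 0 < m₀) (hm : m₀ ≤ m₁) (hE : m₁ ≤ ω * E)
    (hU : ∀ t ∈ Icc (-1 : ℝ) 1, HasDerivAt U (U' t) t)
    (hP : ∀ t ∈ Icc (-1 : ℝ) 1, HasDerivAt P (P' t) t)
    (hv : ∀ t, HasDerivAt v (dv t) t) (hdv : ∀ t, HasDerivAt dv (ddv t) t)
    (hV : ∀ t ∈ Icc (-1 : ℝ) 1, |v t| ≤ V) (hdV : ∀ t ∈ Icc (-1 : ℝ) 1, |dv t| + m₁ ≤ 3 / 4)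
    (hVE : V + E ≤ 3 / 2)
    (hode : ∀ t ∈ Icc (-1 : ℝ) 1, |U t| ≤ 3 / 2 → |P t| ≤ 3 / 4 →
      U' t = P t ∧ |P' t + κ * ((1 - C t / 2) * U t + 3 / 4 * U t ^ 3)| ≤ η)
    (hg : ∀ t ∈ Icc (-1 : ℝ) 1, |κ * (1 - C t / 2 + 9 / 4 * v t ^ 2) - ω ^ 2| ≤ g)
    (hρ : ∀ t ∈ Icc (-1 : ℝ) 1, |ddv t + κ * ((1 - C t / 2) * v t + 3 / 4 * v t ^ 3)| ≤ ρ)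
    (hstep : E * g + 2 * (κ * (9 / 4 * V * E ^ 2 + 3 / 4 * E ^ 3) + ρ + η) < m₁ - m₀)
    (hinit : (P (-1) - dv (-1)) ^ 2 + ω ^ 2 * (U (-1) - v (-1)) ^ 2 ≤ m₀ ^ 2) :
    ∀ t ∈ Icc (-1 : ℝ) 1, (P t - dv t) ^ 2 + ω ^ 2 * (U t - v t) ^ 2 ≤ m₁ ^ 2 := by
  set N : ℝ → ℝ := fun t => (P t - dv t) ^ 2 + ω ^ 2 * (U t - v t) ^ 2 with hN
  set M : ℝ → ℝ := fun t => m₀ + (m₁ - m₀) * (t + 1) / 2 with hM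
  have hNd : ∀ t ∈ Icc (-1 : ℝ) 1, HasDerivAt N (2 * (P t - dv t) * (P' t - ddv t) +
      ω ^ 2 * (2 * (U t - v t) * (U' t - dv t))) t := by
    intro t ht
    have h1 := (((hP t ht).sub (hdv t)).pow 2).add ((((hU t ht).sub (hv t)).pow 2).const_mul (ω ^ 2))
    convert! h1 using 1
    simp
  have hMd : ∀ t, HasDerivAt (fun t => M t ^ 2) (M t * (m₁ - m₀)) t := by
    intro t
    have h1 : HasDerivAt M ((m₁ - m₀) * 1 / 2) t :=
      ((((hasDerivAt_id t).add_const 1).const_mul (m₁ - m₀)).div_const 2).const_add m₀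
    convert! h1.pow 2 using 1
    simp; ring
  have hfin := image_le_of_deriv_right_lt_deriv_boundary' (f := N) (B := fun t => M t ^ 2)
    (a := -1) (b := 1) (fun t ht => (hNd t ht).continuousAt.continuousWithinAt)
    (fun t ht => (hNd t (Ico_subset_Icc_self ht)).hasDerivWithinAt)
    (by simpa [hM, hN] using hinit)
    (fun t ht => (hMd t).continuousAt.continuousWithinAt)
    (fun t ht => (hMd t).hasDerivWithinAt)
    ?_
  · intro t ht
    have hMpos : 0 ≤ M t := by
      have := mul_nonneg (sub_nonneg.2 hm) (by linarith [ht.1] : 0 ≤ t + 1)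
      simp only [hM]; linarith
    have hMle : M t ≤ m₁ := by
      simp only [hM]
      nlinarith [mul_nonneg (sub_nonneg.2 hm) (by linarith [ht.2] : 0 ≤ 1 - t)]
    exact (hfin ht).trans (pow_le_pow_left₀ hMpos hMle 2)
  · intro t ht hNM
    have htc := Ico_subset_Icc_self ht
    have hMpos : 0 < M t := by
      have : 0 ≤ (m₁ - m₀) * (t + 1) / 2 := by
        have := mul_nonneg (sub_nonneg.2 hm) (by linarith [ht.1] : 0 ≤ t + 1)
        linarith
      simp only [hM]; linarith
    have hMle : M t ≤ m₁ := by
      simp only [hM]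
      nlinarith [mul_nonneg (sub_nonneg.2 hm) (by linarith [ht.2] : 0 ≤ 1 - t)]
    have hNM' : (P t - dv t) ^ 2 + ω ^ 2 * (U t - v t) ^ 2 = M t ^ 2 := hNM
    obtain ⟨hU2, hP2⟩ := abs_le_of_energy_le hω hMpos.le (hMle.trans hE) (hV t htc)
      (by linarith [hdV t htc]) hVE hNM'.le
    obtain ⟨hU', hP'⟩ := hode t htc hU2 hP2
    rw [hU']
    exact energy_growth_lt hκ hω hMpos (hMle.trans hE) hNM' (by ring) (hg t htc) (hV t htc)
      (hρ t htc) hP' hstep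

/-! ### Integer polynomials as coefficient lists -/

/-- The value at `x` of the polynomial with the given coefficients, constant term first. -/
def evp : List ℤ → ℝ → ℝ
  | [], _ => 0
  | a :: p, x => a + x * evp p x

def evi : List ℤ → ℤ → ℤ
  | [], _ => 0
  | a :: p, x => a + x * evi p x

def addp : List ℤ → List ℤ → List ℤ
  | [], q => q
  | a :: p, [] => a :: p
  | a :: p, b :: q => (a + b) :: addp p q

def smulp (c : ℤ) : List ℤ → List ℤ
  | [] => []
  | a :: p => (c * a) :: smulp c p

def mulp : List ℤ → List ℤ → List ℤ
  | [], _ => []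
  | a :: p, q => addp (smulp a q) (0 :: mulp p q)

def derp : List ℤ → List ℤ
  | [] => []
  | _ :: p => addp p (0 :: derp p)

def normp : List ℤ → ℤ
  | [] => 0
  | a :: p => a.natAbs + normp p

theorem evp_addp (p q : List ℤ) (x : ℝ) : evp (addp p q) x = evp p x + evp q x := by
  induction p generalizing q with
  | nil => simp [addp, evp]
  | cons a p ih =>
    cases q with
    | nil => simp [addp, evp]
    | cons b q => simp only [addp, evp, ih]; push_cast; ring

theorem evp_smulp (c : ℤ) (p : List ℤ) (x : ℝ) : evp (smulp c p) x = c * evp p x := by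
  induction p with
  | nil => simp [smulp, evp]
  | cons a p ih => simp only [smulp, evp, ih]; push_cast; ring

theorem evp_mulp (p q : List ℤ) (x : ℝ) : evp (mulp p q) x = evp p x * evp q x := by
  induction p with
  | nil => simp [mulp, evp]
  | cons a p ih => simp only [mulp, evp, evp_addp, evp_smulp, ih]; push_cast; ring

theorem hasDerivAt_evp (p : List ℤ) (x : ℝ) : HasDerivAt (evp p) (evp (derp p) x) x := by
  induction p with
  | nil => exact hasDerivAt_const x (0 : ℝ)
  | cons a p ih =>
    have h := ((hasDerivAt_id x).mul ih).const_add (a : ℝ)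
    convert! h using 1
    simp [derp, evp_addp, evp]

theorem abs_evp_le (p : List ℤ) {x : ℝ} (hx : |x| ≤ 1) : |evp p x| ≤ normp p := by
  induction p with
  | nil => simp [evp, normp]
  | cons a p ih =>
    simp only [evp, normp]
    push_cast
    have h1 := abs_add_le (a : ℝ) (x * evp p x)
    have h2 : |x * evp p x| ≤ 1 * |evp p x| := by rw [abs_mul]; gcongr
    linarith

theorem evp_intCast (p : List ℤ) (n : ℤ) : evp p n = evi p n := by
  induction p with
  | nil => simp [evp, evi]
  | cons a p ih => simp [evp, evi, ih]

/-! Polynomials in two variables are lists of polynomials in the first variable, indexed by the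
power of the second. -/

def ev2 : List (List ℤ) → ℝ → ℝ → ℝ
  | [], _, _ => 0
  | p :: P, x, y => evp p x + y * ev2 P x y

def add2 : List (List ℤ) → List (List ℤ) → List (List ℤ)
  | [], Q => Q
  | p :: P, [] => p :: P
  | p :: P, q :: Q => addp p q :: add2 P Q

def smul2 (c : ℤ) : List (List ℤ) → List (List ℤ)
  | [] => []
  | p :: P => smulp c p :: smul2 c P

def mulp2 (p : List ℤ) : List (List ℤ) → List (List ℤ)
  | [] => []
  | q :: Q => mulp p q :: mulp2 p Q

def mul2 : List (List ℤ) → List (List ℤ) → List (List ℤ)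
  | [], _ => []
  | p :: P, Q => add2 (mulp2 p Q) ([] :: mul2 P Q)

def der2 : List (List ℤ) → List (List ℤ)
  | [] => []
  | p :: P => derp p :: der2 P

def norm2 : List (List ℤ) → ℤ
  | [] => 0
  | p :: P => normp p + norm2 P

/-- Substitute an integer for the first variable. -/
def evi2 : List (List ℤ) → ℤ → List ℤ
  | [], _ => []
  | p :: P, x => evi p x :: evi2 P x

theorem ev2_add2 (P Q : List (List ℤ)) (x y : ℝ) :
    ev2 (add2 P Q) x y = ev2 P x y + ev2 Q x y := by
  induction P generalizing Q with
  | nil => simp [add2, ev2]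
  | cons p P ih =>
    cases Q with
    | nil => simp [add2, ev2]
    | cons q Q => simp only [add2, ev2, ih, evp_addp]; ring

theorem ev2_smul2 (c : ℤ) (P : List (List ℤ)) (x y : ℝ) :
    ev2 (smul2 c P) x y = c * ev2 P x y := by
  induction P with
  | nil => simp [smul2, ev2]
  | cons p P ih => simp only [smul2, ev2, ih, evp_smulp]; ring

theorem ev2_mulp2 (p : List ℤ) (P : List (List ℤ)) (x y : ℝ) :
    ev2 (mulp2 p P) x y = evp p x * ev2 P x y := by
  induction P with
  | nil => simp [mulp2, ev2]
  | cons q P ih => simp only [mulp2, ev2, ih, evp_mulp]; ring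

theorem ev2_mul2 (P Q : List (List ℤ)) (x y : ℝ) :
    ev2 (mul2 P Q) x y = ev2 P x y * ev2 Q x y := by
  induction P with
  | nil => simp [mul2, ev2]
  | cons p P ih => simp only [mul2, ev2, ev2_add2, ev2_mulp2, ih, evp]; ring

theorem hasDerivAt_ev2 (P : List (List ℤ)) (x y : ℝ) :
    HasDerivAt (fun x => ev2 P x y) (ev2 (der2 P) x y) x := by
  induction P with
  | nil => exact hasDerivAt_const x (0 : ℝ)
  | cons p P ih => exact (hasDerivAt_evp p x).add (ih.const_mul y)

theorem abs_ev2_le (P : List (List ℤ)) {x y : ℝ} (hx : |x| ≤ 1) (hy : |y| ≤ 1) :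
    |ev2 P x y| ≤ norm2 P := by
  induction P with
  | nil => simp [ev2, norm2]
  | cons p P ih =>
    simp only [ev2, norm2]
    push_cast
    have h1 := abs_add_le (evp p x) (y * ev2 P x y)
    have h2 : |y * ev2 P x y| ≤ 1 * |ev2 P x y| := by rw [abs_mul]; gcongr
    linarith [abs_evp_le p hx]

theorem evp_evi2 (P : List (List ℤ)) (n : ℤ) (y : ℝ) : evp (evi2 P n) y = ev2 P n y := by
  induction P with
  | nil => simp [evp, evi2, ev2]
  | cons p P ih => simp [evp, evi2, ev2, ih, evp_intCast]

theorem cos_sin_taylor {z : ℝ} (hz : |z| ≤ 1) :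
    |cos z - (1 - z ^ 2 / 2 + z ^ 4 / 24 - z ^ 6 / 720 + z ^ 8 / 40320 - z ^ 10 / 3628800 +
      z ^ 12 / 479001600)| ≤ 1 / 43589145600 * |z| ^ 14 ∧
    |sin z - (z - z ^ 3 / 6 + z ^ 5 / 120 - z ^ 7 / 5040 + z ^ 9 / 362880 - z ^ 11 / 39916800 +
      z ^ 13 / 6227020800)| ≤ 1 / 43589145600 * |z| ^ 14 := by
  have h := Complex.exp_bound' (x := z * Complex.I) (n := 14) (by
    simp only [norm_mul, Complex.norm_real, Complex.norm_I, Real.norm_eq_abs]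
    norm_num; linarith)
  have hI : ∀ n : ℕ, Complex.I ^ (n + 2) = -Complex.I ^ n := fun n => by
    rw [pow_add, Complex.I_sq]; ring
  have hsum : ∑ m ∈ Finset.range 14, ((z : ℂ) * Complex.I) ^ m / m.factorial =
      ((1 - z ^ 2 / 2 + z ^ 4 / 24 - z ^ 6 / 720 + z ^ 8 / 40320 - z ^ 10 / 3628800 +
      z ^ 12 / 479001600 : ℝ) : ℂ) + ((z - z ^ 3 / 6 + z ^ 5 / 120 - z ^ 7 / 5040 +
      z ^ 9 / 362880 - z ^ 11 / 39916800 + z ^ 13 / 6227020800 : ℝ) : ℂ) * Complex.I := by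
    simp only [Finset.sum_range_succ, Finset.sum_range_zero, mul_pow, hI, Nat.factorial]
    push_cast
    ring
  have hb : ‖(z : ℂ) * Complex.I‖ ^ 14 / (14).factorial * 2 = 1 / 43589145600 * |z| ^ 14 := by
    simp only [norm_mul, Complex.norm_real, Complex.norm_I, Real.norm_eq_abs, Nat.factorial]
    norm_num; ring
  rw [hsum, hb, Complex.exp_mul_I, ← Complex.ofReal_cos, ← Complex.ofReal_sin] at h
  have key : ∀ a b c s ε : ℝ, ‖(c : ℂ) + s * Complex.I - (a + b * Complex.I)‖ ≤ ε →
      |c - a| ≤ ε ∧ |s - b| ≤ ε := fun a b c s ε h =>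
    ⟨by simpa using (Complex.abs_re_le_norm _).trans h,
      by simpa using (Complex.abs_im_le_norm _).trans h⟩
  exact key _ _ _ _ _ h

/-- Coefficients approximating `10 ^ 11 * cos (π * (x + 2 * i + 1) / 4)`. -/
def cosCoeff : ℕ → List ℤ
  | 0 => [70710678119, -55536036727, -21808950624, 5709569922, 1121071433, -176097489, -23051107,
      2586328, 253912, -22158, -1740, 124, 8]
  | 1 => [-70710678119, -55536036727, 21808950624, 5709569922, -1121071433, -176097489, 23051107,
      2586328, -253912, -22158, 1740, 124, -8]
  | 2 => [-70710678119, 55536036727, 21808950624, -5709569922, -1121071433, 176097489, 23051107,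
      -2586328, -253912, 22158, 1740, -124, -8]
  | 3 => [70710678119, 55536036727, -21808950624, -5709569922, 1121071433, 176097489, -23051107,
      -2586328, 253912, 22158, -1740, -124, 8]
  | n + 4 => cosCoeff n

theorem pi_div_four_mem : (0.785398163397448 : ℝ) ≤ π / 4 ∧ π / 4 ≤ 0.785398163397449 :=
  ⟨by linarith [Real.pi_gt_d20], by linarith [Real.pi_lt_d20]⟩

theorem sqrt_two_div_two_mem : (0.70710678118654 : ℝ) ≤ √2 / 2 ∧ √2 / 2 ≤ 0.70710678118655 := by
  have h1 : (1.41421356237308 : ℝ) ≤ √2 := Real.le_sqrt_of_sq_le (by norm_num)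
  have h2 : √2 ≤ (1.4142135623731 : ℝ) := Real.sqrt_le_iff.2 ⟨by norm_num, by norm_num⟩
  constructor <;> linarith

theorem abs_taylor_coeff_sub_le (k : ℕ) (f c : ℝ) (hf : 0 < f)
    (h1 : (c - 1) * f ≤ 10 ^ 11 * 0.70710678118654 * 0.785398163397448 ^ k)
    (h2 : 10 ^ 11 * 0.70710678118655 * 0.785398163397449 ^ k ≤ (c + 1) * f) :
    |10 ^ 11 * (√2 / 2) * (π / 4) ^ k / f - c| ≤ 1 := by
  obtain ⟨hp1, hp2⟩ := pi_div_four_mem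
  obtain ⟨hs1, hs2⟩ := sqrt_two_div_two_mem
  have e1 : (10 : ℝ) ^ 11 * 0.70710678118654 * 0.785398163397448 ^ k ≤
      10 ^ 11 * (√2 / 2) * (π / 4) ^ k := by gcongr
  have e2 : 10 ^ 11 * (√2 / 2) * (π / 4) ^ k ≤
      (10 : ℝ) ^ 11 * 0.70710678118655 * 0.785398163397449 ^ k := by gcongr
  rw [abs_le]
  constructor
  · have : c - 1 ≤ 10 ^ 11 * (√2 / 2) * (π / 4) ^ k / f := (le_div_iff₀ hf).2 (h1.trans e1)
    linarith
  · have : 10 ^ 11 * (√2 / 2) * (π / 4) ^ k / f ≤ c + 1 := (div_le_iff₀ hf).2 (e2.trans h2)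
    linarith

theorem abs_scaled_cos_sin_sub_le {x : ℝ} (hx : |x| ≤ 1) :
    |10 ^ 11 * (√2 / 2) * cos (π / 4 * x) - (70710678119 - 21808950624 * x ^ 2 +
      1121071433 * x ^ 4 - 23051107 * x ^ 6 + 253912 * x ^ 8 - 1740 * x ^ 10 + 8 * x ^ 12)| ≤ 8 ∧
    |10 ^ 11 * (√2 / 2) * sin (π / 4 * x) - (55536036727 * x - 5709569922 * x ^ 3 +
      176097489 * x ^ 5 - 2586328 * x ^ 7 + 22158 * x ^ 9 - 124 * x ^ 11)| ≤ 8 := by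
  obtain ⟨hp1, hp2⟩ := pi_div_four_mem
  obtain ⟨hs1, hs2⟩ := sqrt_two_div_two_mem
  have hz : |π / 4 * x| ≤ 1 := by
    rw [abs_mul, abs_of_nonneg (by linarith)]
    calc π / 4 * |x| ≤ 1 * 1 := by gcongr; linarith
      _ = 1 := one_mul 1
  obtain ⟨hc, hs⟩ := cos_sin_taylor hz
  have hz14 : 1 / 43589145600 * |π / 4 * x| ^ 14 ≤ 1 / 43589145600 := by
    have := pow_le_one₀ (n := 14) (abs_nonneg _) hz
    linarith
  have hA : ∀ a b : ℝ, |a - b| ≤ 1 / 43589145600 * |π / 4 * x| ^ 14 →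
      |10 ^ 11 * (√2 / 2) * a - 10 ^ 11 * (√2 / 2) * b| ≤ 10 ^ 11 * (0.70710678118655) *
      (1 / 43589145600 * 0.785398163397449 ^ 14) := by
    intro a b hab
    rw [← mul_sub, abs_mul, abs_of_nonneg (by positivity)]
    have : |π / 4 * x| ^ 14 ≤ 0.785398163397449 ^ 14 := by
      gcongr
      rw [abs_mul, abs_of_nonneg (by linarith)]
      nlinarith [abs_nonneg x]
    gcongr
    linarith
  have hpow : ∀ (k : ℕ) (f c : ℝ), |10 ^ 11 * (√2 / 2) * (π / 4) ^ k / f - c| ≤ 1 →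
      |(10 ^ 11 * (√2 / 2) * (π / 4) ^ k / f - c) * x ^ k| ≤ 1 := by
    intro k f c h
    rw [abs_mul, abs_pow]
    exact mul_le_one₀ h (by positivity) (pow_le_one₀ (abs_nonneg _) hx)
  constructor
  · have h0 := abs_le.1 (hpow 0 1 70710678119
      (abs_taylor_coeff_sub_le _ _ _ (by norm_num) (by norm_num) (by norm_num)))
    have h2 := abs_le.1 (hpow 2 2 21808950624
      (abs_taylor_coeff_sub_le _ _ _ (by norm_num) (by norm_num) (by norm_num)))
    have h4 := abs_le.1 (hpow 4 24 1121071433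
      (abs_taylor_coeff_sub_le _ _ _ (by norm_num) (by norm_num) (by norm_num)))
    have h6 := abs_le.1 (hpow 6 720 23051107
      (abs_taylor_coeff_sub_le _ _ _ (by norm_num) (by norm_num) (by norm_num)))
    have h8 := abs_le.1 (hpow 8 40320 253912
      (abs_taylor_coeff_sub_le _ _ _ (by norm_num) (by norm_num) (by norm_num)))
    have h10 := abs_le.1 (hpow 10 3628800 1740
      (abs_taylor_coeff_sub_le _ _ _ (by norm_num) (by norm_num) (by norm_num)))
    have h12 := abs_le.1 (hpow 12 479001600 8
      (abs_taylor_coeff_sub_le _ _ _ (by norm_num) (by norm_num) (by norm_num)))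
    have h := abs_le.1 (hA _ _ hc)
    norm_num at h
    generalize cos (π / 4 * x) = C at *
    generalize √2 / 2 = S at *
    rw [abs_le]
    constructor <;> ring_nf at * <;> linarith
  · have h1 := abs_le.1 (hpow 1 1 55536036727
      (abs_taylor_coeff_sub_le _ _ _ (by norm_num) (by norm_num) (by norm_num)))
    have h3 := abs_le.1 (hpow 3 6 5709569922
      (abs_taylor_coeff_sub_le _ _ _ (by norm_num) (by norm_num) (by norm_num)))
    have h5 := abs_le.1 (hpow 5 120 176097489
      (abs_taylor_coeff_sub_le _ _ _ (by norm_num) (by norm_num) (by norm_num)))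
    have h7 := abs_le.1 (hpow 7 5040 2586328
      (abs_taylor_coeff_sub_le _ _ _ (by norm_num) (by norm_num) (by norm_num)))
    have h9 := abs_le.1 (hpow 9 362880 22158
      (abs_taylor_coeff_sub_le _ _ _ (by norm_num) (by norm_num) (by norm_num)))
    have h11 := abs_le.1 (hpow 11 39916800 124
      (abs_taylor_coeff_sub_le _ _ _ (by norm_num) (by norm_num) (by norm_num)))
    have h13 := abs_le.1 (hpow 13 6227020800 0
      (abs_taylor_coeff_sub_le _ _ _ (by norm_num) (by norm_num) (by norm_num)))
    have h := abs_le.1 (hA _ _ hs)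
    norm_num at h
    generalize sin (π / 4 * x) = C at *
    generalize √2 / 2 = S at *
    rw [abs_le]
    constructor <;> ring_nf at * <;> linarith

theorem abs_cos_sub_cosCoeff_le (i : ℕ) {x : ℝ} (hx : |x| ≤ 1) :
    |cos (π / 4 * (x + 2 * i + 1)) - evp (cosCoeff i) x / 10 ^ 11| ≤ 20 / 10 ^ 11 := by
  induction i using cosCoeff.induct with
  | case5 n ih =>
    have : π / 4 * (x + 2 * ((n + 4 : ℕ) : ℝ) + 1) = π / 4 * (x + 2 * n + 1) + 2 * π := by
      push_cast; ring
    rw [this, cos_add_two_pi]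
    exact ih
  | case1 =>
    have h : π / 4 * (x + 2 * ((0 : ℕ) : ℝ) + 1) = π / 4 * x + π / 4 := by push_cast; ring
    rw [h, cos_add, cos_pi_div_four, sin_pi_div_four]
    obtain ⟨hc, hs⟩ := abs_scaled_cos_sin_sub_le hx
    rw [abs_le] at *
    simp only [cosCoeff, evp]; push_cast
    constructor <;> linarith
  | case2 =>
    have h : π / 4 * (x + 2 * ((1 : ℕ) : ℝ) + 1) = π / 4 * x + π / 4 + π / 2 := by push_cast; ring
    rw [h, cos_add_pi_div_two, sin_add, cos_pi_div_four, sin_pi_div_four]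
    obtain ⟨hc, hs⟩ := abs_scaled_cos_sin_sub_le hx
    rw [abs_le] at *
    simp only [cosCoeff, evp]; push_cast
    constructor <;> linarith
  | case3 =>
    have h : π / 4 * (x + 2 * ((2 : ℕ) : ℝ) + 1) = π / 4 * x + π / 4 + π := by push_cast; ring
    rw [h, cos_add_pi, cos_add, cos_pi_div_four, sin_pi_div_four]
    obtain ⟨hc, hs⟩ := abs_scaled_cos_sin_sub_le hx
    rw [abs_le] at *
    simp only [cosCoeff, evp]; push_cast
    constructor <;> linarith
  | case4 =>
    have h : π / 4 * (x + 2 * ((3 : ℕ) : ℝ) + 1) = π / 4 * x + π / 4 + π / 2 + π := by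
      push_cast; ring
    rw [h, cos_add_pi, cos_add_pi_div_two, sin_add, cos_pi_div_four, sin_pi_div_four]
    obtain ⟨hc, hs⟩ := abs_scaled_cos_sin_sub_le hx
    rw [abs_le] at *
    simp only [cosCoeff, evp]; push_cast
    constructor <;> linarith

/-! ### Validated integration over a quarter period -/

/-- Approximate endpoint values and derivatives (as polynomials in the family parameter) with the
energy weight and the error bound, all in units of `10 ^ (-11)`. -/
structure Endpoint where
  val : List ℤ
  der : List ℤ
  w : ℤ
  m : ℤ

/-- An approximate family of solutions on a time interval of length `π / 4`. -/
structure Piece where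
  poly : List (List ℤ)
  w : ℤ
  m₀ : ℤ
  m₁ : ℤ
  E : ℤ

def Piece.endpoint (p : Piece) : Endpoint :=
  ⟨evi2 p.poly 1, evi2 (der2 p.poly) 1, p.w, p.m₁⟩

/-- `10 ^ 11 * (1.1025 * π ^ 2 / 64)`, rounded. -/
def scaledKappa : ℤ := 17001935706

def Piece.residual (p : Piece) (C : List ℤ) : List (List ℤ) :=
  add2 (smul2 (4 * 10 ^ 33) (der2 (der2 p.poly)))
    (smul2 scaledKappa (mul2 p.poly (add2 [addp [4 * 10 ^ 22] (smulp (-2 * 10 ^ 11) C)]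
      (smul2 3 (mul2 p.poly p.poly)))))

def Piece.linearization (p : Piece) (C : List ℤ) : List (List ℤ) :=
  add2 [[-4 * 10 ^ 11 * p.w ^ 2]]
    (smul2 scaledKappa (add2 [addp [4 * 10 ^ 22] (smulp (-2 * 10 ^ 11) C)]
      (smul2 9 (mul2 p.poly p.poly))))

def Piece.check (p : Piece) (C : List ℤ) (e : Endpoint) : Bool :=
  decide (0 < p.m₀) && decide (p.m₀ ≤ p.m₁) && decide (0 < p.w) && decide (p.w ≤ e.w) &&
  decide (0 ≤ e.m) && decide (p.m₁ * 10 ^ 11 ≤ p.w * p.E) &&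
  decide (10 ^ 11 * e.m + 10 ^ 11 * normp (addp e.der (smulp (-1) (evi2 (der2 p.poly) (-1)))) +
    e.w * normp (addp e.val (smulp (-1) (evi2 p.poly (-1)))) ≤ 10 ^ 11 * p.m₀) &&
  decide (2 * (norm2 p.poly + p.E) ≤ 3 * 10 ^ 11) &&
  decide (4 * (norm2 (der2 p.poly) + p.m₁) ≤ 3 * 10 ^ 11) &&
  decide (p.E * norm2 (p.linearization C) + 18 * scaledKappa * norm2 p.poly * p.E ^ 2 +
    6 * scaledKappa * p.E ^ 3 + 2 * norm2 (p.residual C) + 64 * 10 ^ 33 <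
    4 * 10 ^ 33 * (p.m₁ - p.m₀))

/-- The trajectory with initial height `s` at time `t` is within the error bound of the endpoint. -/
def Near (s ς t : ℝ) (e : Endpoint) : Prop :=
  (π / 8 * (traj s t).2 - evp e.der ς / 10 ^ 11) ^ 2 +
    (e.w / 10 ^ 11) ^ 2 * ((traj s t).1 - evp e.val ς / 10 ^ 11) ^ 2 ≤ (e.m / 10 ^ 11) ^ 2

theorem energy_add_le {a b x y X Y m m₀ w w' : ℝ} (hm : 0 ≤ m) (hw' : 0 < w') (hw : w' ≤ w)
    (h : a ^ 2 + w ^ 2 * b ^ 2 ≤ m ^ 2) (hx : |x| ≤ X) (hy : |y| ≤ Y)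
    (hm₀ : m + X + w * Y ≤ m₀) : (a + x) ^ 2 + w' ^ 2 * (b + y) ^ 2 ≤ m₀ ^ 2 := by
  have hw0 : 0 < w := hw'.trans_le hw
  have hX := (abs_nonneg x).trans hx
  have hY := (abs_nonneg y).trans hy
  have ha : |a| ≤ m := abs_le_of_sq_le_sq (by nlinarith [sq_nonneg (w * b)]) hm
  have hb : w * |b| ≤ m := by
    have h1 : |w * b| ≤ m := abs_le_of_sq_le_sq (by nlinarith [sq_nonneg a]) hm
    rwa [abs_mul, abs_of_pos hw0] at h1
  have h1 : (a + x) ^ 2 ≤ (|a| + X) ^ 2 :=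
    sq_le_sq' (by linarith [neg_abs_le a, neg_abs_le x]) (by linarith [le_abs_self a, le_abs_self x])
  have h2 : (b + y) ^ 2 ≤ (|b| + Y) ^ 2 :=
    sq_le_sq' (by linarith [neg_abs_le b, neg_abs_le y]) (by linarith [le_abs_self b, le_abs_self y])
  have h3 : w' ^ 2 * (b + y) ^ 2 ≤ w ^ 2 * (|b| + Y) ^ 2 := by gcongr
  have h4 : (m + X + w * Y) ^ 2 ≤ m₀ ^ 2 := by gcongr
  have h5 : |a| * X + w * |b| * (w * Y) ≤ m * (X + w * Y) := by
    have e1 : |a| * X ≤ m * X := by gcongr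
    have e2 : w * |b| * (w * Y) ≤ m * (w * Y) := by gcongr
    linarith
  have h6 : X ^ 2 + (w * Y) ^ 2 ≤ (X + w * Y) ^ 2 := by nlinarith [mul_nonneg hX (mul_nonneg hw0.le hY)]
  have h7 : |a| ^ 2 + (w * |b|) ^ 2 ≤ m ^ 2 := by rw [mul_pow, sq_abs, sq_abs]; exact h
  nlinarith

theorem abs_kappa_sub_le :
    |1.1025 * (π / 8) ^ 2 - (scaledKappa : ℝ) / 10 ^ 11| ≤ 1 / 10 ^ 11 := by
  have h1 := Real.pi_gt_d20
  have h2 := Real.pi_lt_d20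
  have h3 : (3.14159265358979 : ℝ) ^ 2 ≤ π ^ 2 := by gcongr; linarith
  have h4 : π ^ 2 ≤ (3.1415926535898 : ℝ) ^ 2 := by gcongr; linarith
  unfold scaledKappa
  push_cast
  rw [abs_le]
  constructor <;> norm_num at h3 h4 ⊢ <;> linarith

theorem Piece.near_endpoint {p : Piece} {e : Endpoint} {i : ℕ} {s ς : ℝ} (hς : |ς| ≤ 1)
    (hc : p.check (cosCoeff i) e = true) (h : Near s ς (π / 4 * i) e) :
    Near s ς (π / 4 * (i + 1 : ℕ)) p.endpoint ∧
      ∀ t ∈ Icc (π / 4 * i) (π / 4 * (i + 1)), |(traj s t).1| ≤ 3 / 2 ∧ |(traj s t).2| ≤ 2 := by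
  simp only [Piece.check, Bool.and_eq_true, decide_eq_true_eq] at hc
  obtain ⟨⟨⟨⟨⟨⟨⟨⟨⟨hm₀, hm⟩, hw⟩, hwe⟩, hem⟩, hE⟩, hjump⟩, hVE⟩, hdV⟩, hstep⟩ := hc
  have hm₀' : (0 : ℝ) < p.m₀ := by exact_mod_cast hm₀
  have hm' : (p.m₀ : ℝ) ≤ p.m₁ := by exact_mod_cast hm
  have hw' : (0 : ℝ) < p.w := by exact_mod_cast hw
  have hwe' : (p.w : ℝ) ≤ e.w := by exact_mod_cast hwe
  have hem' : (0 : ℝ) ≤ e.m := by exact_mod_cast hem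
  have hE' : (p.m₁ : ℝ) * 10 ^ 11 ≤ p.w * p.E := by exact_mod_cast hE
  have hjump' : (10 : ℝ) ^ 11 * e.m +
      10 ^ 11 * normp (addp e.der (smulp (-1) (evi2 (der2 p.poly) (-1)))) +
      e.w * normp (addp e.val (smulp (-1) (evi2 p.poly (-1)))) ≤ 10 ^ 11 * p.m₀ := by
    exact_mod_cast hjump
  have hVE' : 2 * ((norm2 p.poly : ℝ) + p.E) ≤ 3 * 10 ^ 11 := by exact_mod_cast hVE
  have hdV' : 4 * ((norm2 (der2 p.poly) : ℝ) + p.m₁) ≤ 3 * 10 ^ 11 := by exact_mod_cast hdV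
  have hstep' : (p.E : ℝ) * norm2 (p.linearization (cosCoeff i)) +
      18 * scaledKappa * norm2 p.poly * p.E ^ 2 + 6 * scaledKappa * p.E ^ 3 +
      2 * norm2 (p.residual (cosCoeff i)) + 64 * 10 ^ 33 < 4 * 10 ^ 33 * (p.m₁ - p.m₀) := by
    exact_mod_cast hstep
  clear hm₀ hm hw hwe hem hE hjump hVE hdV hstep
  set T : ℝ → ℝ := fun τ => π / 8 * (τ + 2 * i + 1) with hT
  have hTd : ∀ τ, HasDerivAt T (π / 8) τ := fun τ => by
    simpa using ((((hasDerivAt_id τ).add_const (2 * (i : ℝ))).add_const 1).const_mul (π / 8))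
  set U : ℝ → ℝ := fun τ => (traj s (T τ)).1 with hU
  set P : ℝ → ℝ := fun τ => π / 8 * (traj s (T τ)).2 with hP
  set v : ℝ → ℝ := fun τ => ev2 p.poly τ ς / 10 ^ 11 with hv
  set dv : ℝ → ℝ := fun τ => ev2 (der2 p.poly) τ ς / 10 ^ 11 with hdv
  set ddv : ℝ → ℝ := fun τ => ev2 (der2 (der2 p.poly)) τ ς / 10 ^ 11 with hddv
  set C : ℝ → ℝ := fun τ => evp (cosCoeff i) τ / 10 ^ 11 with hC
  have hIcc : ∀ {τ : ℝ}, τ ∈ Icc (-1 : ℝ) 1 → |τ| ≤ 1 := fun h => abs_le.2 h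
  have hVb : ∀ τ ∈ Icc (-1 : ℝ) 1, |v τ| ≤ norm2 p.poly / 10 ^ 11 := fun τ hτ => by
    simp only [hv]
    rw [abs_div, abs_of_pos (by positivity : (0 : ℝ) < 10 ^ 11)]
    have := abs_ev2_le p.poly (hIcc hτ) hς
    gcongr
  have hdVb : ∀ τ ∈ Icc (-1 : ℝ) 1, |dv τ| + p.m₁ / 10 ^ 11 ≤ 3 / 4 := fun τ hτ => by
    simp only [hdv]
    rw [abs_div, abs_of_pos (by positivity : (0 : ℝ) < 10 ^ 11)]
    have := abs_ev2_le (der2 p.poly) (hIcc hτ) hς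
    rw [← add_div, div_le_iff₀ (by positivity)]
    linarith
  have hVEb : (norm2 p.poly : ℝ) / 10 ^ 11 + p.E / 10 ^ 11 ≤ 3 / 2 := by
    rw [← add_div, div_le_iff₀ (by positivity)]; linarith
  have hEb : (p.m₁ : ℝ) / 10 ^ 11 ≤ p.w / 10 ^ 11 * (p.E / 10 ^ 11) := by
    rw [div_mul_div_comm, div_le_div_iff₀ (by positivity) (by positivity)]
    nlinarith
  have hωpos : (0 : ℝ) < p.w / 10 ^ 11 := by positivity
  have hm₁pos : (0 : ℝ) ≤ p.m₁ := hm₀'.le.trans hm'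
  have hlast : T (-1) = π / 4 * i := by simp only [hT]; ring
  have hnext : T 1 = π / 4 * (i + 1 : ℕ) := by simp only [hT]; push_cast; ring
  have hclipP : ∀ {y : ℝ}, |π / 8 * y| ≤ 3 / 4 → |y| ≤ 2 := fun {y} hy => by
    rw [abs_mul, abs_of_pos (by positivity)] at hy
    nlinarith [abs_nonneg y, Real.pi_gt_three]
  have hen := energy_step (U := U) (U' := fun τ => clip (traj s (T τ)).2 * (π / 8)) (P := P)
    (P' := fun τ => π / 8 * (-(1.1025 * ((1 - cos (2 * T τ) / 2) * clip (U τ) +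
      3 / 4 * clip (U τ) ^ 3)) * (π / 8))) (v := v) (dv := dv) (ddv := ddv)
    (C := C) (κ := scaledKappa / 10 ^ 11) (ω := p.w / 10 ^ 11) (m₀ := p.m₀ / 10 ^ 11)
    (m₁ := p.m₁ / 10 ^ 11) (E := p.E / 10 ^ 11) (V := norm2 p.poly / 10 ^ 11)
    (g := norm2 (p.linearization (cosCoeff i)) / (4 * 10 ^ 33))
    (ρ := norm2 (p.residual (cosCoeff i)) / (4 * 10 ^ 44)) (η := 8 / 10 ^ 11)
    (by norm_num [scaledKappa]) hωpos (by positivity) (by gcongr) hEb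
    (fun τ _ => (hasDerivAt_traj_fst s (T τ)).comp τ (hTd τ))
    (fun τ _ => ((hasDerivAt_traj_snd s (T τ)).comp τ (hTd τ)).const_mul (π / 8))
    (fun τ => (hasDerivAt_ev2 p.poly τ ς).div_const _)
    (fun τ => (hasDerivAt_ev2 (der2 p.poly) τ ς).div_const _)
    hVb hdVb hVEb ?_ ?_ ?_ ?_ ?_
  · constructor
    · have h1 := hen 1 (by simp)
      simp only [hU, hP, hv, hdv, hnext] at h1
      unfold Near Piece.endpoint
      simpa only [evp_evi2, Int.cast_one] using h1
    · intro t ht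
      have hτ : 8 / π * t - 2 * i - 1 ∈ Icc (-1 : ℝ) 1 := by
        have hpi := Real.pi_pos
        have e : 8 / π * t - 2 * i - 1 = 8 / π * (t - π / 4 * i) - 1 := by field_simp; ring
        have e1 : 0 ≤ 8 / π * (t - π / 4 * i) :=
          mul_nonneg (by positivity) (sub_nonneg.2 ht.1)
        have e2 : 8 / π * (t - π / 4 * i) ≤ 8 / π * (π / 4) := by
          gcongr; linarith [ht.2]
        have e3 : 8 / π * (π / 4) = 2 := by field_simp; norm_num
        rw [e]; constructor <;> linarith
      have hTτ : T (8 / π * t - 2 * i - 1) = t := by simp only [hT]; field_simp; ring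
      have h1 := abs_le_of_energy_le hωpos (by positivity : 0 ≤ (p.m₁ : ℝ) / 10 ^ 11) hEb (hVb _ hτ)
        (hdVb _ hτ) hVEb (hen _ hτ)
      simp only [hU, hP, hTτ] at h1
      exact ⟨h1.1, hclipP h1.2⟩
  · intro τ hτ hUb hPb
    have hPb' := hclipP hPb
    have hU2 : clip (U τ) = U τ := clip_of_abs_le (by linarith)
    refine ⟨by simp only [hP, clip_of_abs_le hPb']; ring, ?_⟩
    rw [hU2]
    have hcos : |cos (2 * T τ) - C τ| ≤ 20 / 10 ^ 11 := by
      have := abs_cos_sub_cosCoeff_le i (hIcc hτ)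
      convert this using 4
      simp only [hT]; ring
    have hk := abs_kappa_sub_le
    have e : π / 8 * (-(1.1025 * ((1 - cos (2 * T τ) / 2) * U τ + 3 / 4 * U τ ^ 3)) * (π / 8)) +
        scaledKappa / 10 ^ 11 * ((1 - C τ / 2) * U τ + 3 / 4 * U τ ^ 3) =
        -((1.1025 * (π / 8) ^ 2 - scaledKappa / 10 ^ 11) *
          ((1 - cos (2 * T τ) / 2) * U τ + 3 / 4 * U τ ^ 3)) +
        scaledKappa / 10 ^ 11 * ((cos (2 * T τ) - C τ) / 2 * U τ) := by ring
    rw [e]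
    have h1 : |(1 - cos (2 * T τ) / 2) * U τ + 3 / 4 * U τ ^ 3| ≤
        3 / 2 * (3 / 2) + 3 / 4 * (3 / 2) ^ 3 := by
      refine (abs_add_le _ _).trans ?_
      rw [abs_mul, abs_mul, abs_pow, abs_of_pos (by norm_num : (0 : ℝ) < 3 / 4)]
      have : |1 - cos (2 * T τ) / 2| ≤ 3 / 2 := by
        rw [abs_le]; constructor <;> linarith [neg_one_le_cos (2 * T τ), cos_le_one (2 * T τ)]
      gcongr
    have h2 : |(cos (2 * T τ) - C τ) / 2 * U τ| ≤ 20 / 10 ^ 11 / 2 * (3 / 2) := by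
      rw [abs_mul, abs_div, abs_two]; gcongr
    have h3 : |(1.1025 * (π / 8) ^ 2 - (scaledKappa : ℝ) / 10 ^ 11) *
        ((1 - cos (2 * T τ) / 2) * U τ + 3 / 4 * U τ ^ 3)| ≤
        1 / 10 ^ 11 * (3 / 2 * (3 / 2) + 3 / 4 * (3 / 2) ^ 3) := by
      rw [abs_mul]; gcongr
    have h4 : |(scaledKappa : ℝ) / 10 ^ 11 * ((cos (2 * T τ) - C τ) / 2 * U τ)| ≤
        (scaledKappa : ℝ) / 10 ^ 11 * (20 / 10 ^ 11 / 2 * (3 / 2)) := by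
      rw [abs_mul, abs_of_pos (by norm_num [scaledKappa] : (0 : ℝ) < scaledKappa / 10 ^ 11)]
      have : (0 : ℝ) < scaledKappa / 10 ^ 11 := by norm_num [scaledKappa]
      gcongr
    refine (abs_add_le _ _).trans ?_
    rw [abs_neg]
    refine (add_le_add h3 h4).trans ?_
    norm_num [scaledKappa]
  · intro τ hτ
    have e : (scaledKappa : ℝ) / 10 ^ 11 * (1 - C τ / 2 + 9 / 4 * v τ ^ 2) - (p.w / 10 ^ 11) ^ 2 =
        ev2 (p.linearization (cosCoeff i)) τ ς / (4 * 10 ^ 33) := by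
      simp only [Piece.linearization, ev2_add2, ev2_smul2, ev2_mul2, ev2, evp_addp, evp_smulp, evp,
        hC, hv]
      push_cast; ring
    rw [e, abs_div, abs_of_pos (by positivity : (0 : ℝ) < 4 * 10 ^ 33)]
    have := abs_ev2_le (p.linearization (cosCoeff i)) (hIcc hτ) hς
    gcongr
  · intro τ hτ
    have e : ddv τ + scaledKappa / 10 ^ 11 * ((1 - C τ / 2) * v τ + 3 / 4 * v τ ^ 3) =
        ev2 (p.residual (cosCoeff i)) τ ς / (4 * 10 ^ 44) := by
      simp only [Piece.residual, ev2_add2, ev2_smul2, ev2_mul2, ev2, evp_addp, evp_smulp, evp,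
        hC, hv, hddv]
      push_cast; ring
    rw [e, abs_div, abs_of_pos (by positivity : (0 : ℝ) < 4 * 10 ^ 44)]
    have := abs_ev2_le (p.residual (cosCoeff i)) (hIcc hτ) hς
    gcongr
  · rw [← sub_pos] at hstep' ⊢
    have h1 := div_pos hstep' (by positivity : (0 : ℝ) < 4 * 10 ^ 44)
    refine lt_of_lt_of_eq h1 ?_
    ring
  · unfold Near at h
    have hx := abs_evp_le (addp e.der (smulp (-1) (evi2 (der2 p.poly) (-1)))) hς
    have hy := abs_evp_le (addp e.val (smulp (-1) (evi2 p.poly (-1)))) hς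
    simp only [evp_addp, evp_smulp, evp_evi2] at hx hy
    push_cast at hx hy
    have h1 := energy_add_le (x := (evp e.der ς + -1 * ev2 (der2 p.poly) (-1) ς) / 10 ^ 11)
      (y := (evp e.val ς + -1 * ev2 p.poly (-1) ς) / 10 ^ 11) (w' := p.w / 10 ^ 11)
      (m₀ := p.m₀ / 10 ^ 11)
      (X := normp (addp e.der (smulp (-1) (evi2 (der2 p.poly) (-1)))) / 10 ^ 11)
      (Y := normp (addp e.val (smulp (-1) (evi2 p.poly (-1)))) / 10 ^ 11)
      (by positivity : 0 ≤ (e.m : ℝ) / 10 ^ 11) hωpos (by gcongr) h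
      (by rw [abs_div, abs_of_pos (by positivity : (0 : ℝ) < 10 ^ 11)]; gcongr)
      (by rw [abs_div, abs_of_pos (by positivity : (0 : ℝ) < 10 ^ 11)]; gcongr)
      (by
        rw [← sub_nonneg] at hjump' ⊢
        refine le_of_le_of_eq (div_nonneg hjump' (by positivity : (0 : ℝ) ≤ 10 ^ 22)) ?_
        ring)
    simp only [hU, hP, hv, hdv, hlast]
    convert h1 using 2 <;> ring

def checkChain : List Piece → ℕ → Endpoint → Bool
  | [], _, _ => true
  | p :: ps, i, e => p.check (cosCoeff i) e && checkChain ps (i + 1) p.endpoint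

def lastEndpoint : List Piece → Endpoint → Endpoint
  | [], e => e
  | p :: ps, _ => lastEndpoint ps p.endpoint

theorem near_lastEndpoint {s ς : ℝ} (hς : |ς| ≤ 1) (ps : List Piece) {i : ℕ} {e : Endpoint}
    (hc : checkChain ps i e = true) (h : Near s ς (π / 4 * i) e) :
    Near s ς (π / 4 * (i + ps.length : ℕ)) (lastEndpoint ps e) ∧
      ∀ t ∈ Ico (π / 4 * i) (π / 4 * (i + ps.length : ℕ)),
        |(traj s t).1| ≤ 3 / 2 ∧ |(traj s t).2| ≤ 2 := by
  induction ps generalizing i e with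
  | nil => exact ⟨by simpa [lastEndpoint] using h, fun t ht => by simp at ht⟩
  | cons p ps ih =>
    rw [checkChain, Bool.and_eq_true] at hc
    obtain ⟨h1, h2⟩ := Piece.near_endpoint hς hc.1 h
    obtain ⟨h3, h4⟩ := ih hc.2 h1
    rw [List.length_cons, Nat.add_comm ps.length 1, ← Nat.add_assoc]
    refine ⟨h3, fun t ht => ?_⟩
    by_cases hti : t ≤ π / 4 * (i + 1)
    · exact h2 t ⟨ht.1, hti⟩
    · exact h4 t ⟨by push_cast; linarith, ht.2⟩

def initialEndpoint : Endpoint := ⟨[71213700000, 1200000000], [0], 10 ^ 11, 0⟩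

theorem near_initialEndpoint (ς : ℝ) :
    Near (0.712137 + 0.012 * ς) ς (π / 4 * (0 : ℕ)) initialEndpoint := by
  have : (0.712137 + 0.012 * ς) - (71213700000 + ς * 1200000000) / 10 ^ 11 = 0 := by ring
  simp [Near, initialEndpoint, traj_zero, evp, this]

/-! ### Shooting -/

theorem isOpen_setOf_exists_forall_Icc {f g : ℝ → ℝ → ℝ} {T : ℝ}
    (hf : ∀ s, ∀ x ≥ T, ContinuousAt (fun z : ℝ × ℝ => f z.1 z.2) (s, x))
    (hg : ∀ s, ∀ x ≥ T, ContinuousAt (fun z : ℝ × ℝ => g z.1 z.2) (s, x)) :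
    IsOpen {s | ∃ x ≥ T, 0 < f s x ∧ ∀ y ∈ Icc T x, 0 < g s y} := by
  rw [isOpen_iff_mem_nhds]
  rintro s ⟨x, hx, hfx, hgx⟩
  have h1 : ∀ᶠ s' in 𝓝 s, 0 < f s' x := by
    have hc : ContinuousAt (fun s' => f s' x) s :=
      ContinuousAt.comp (f := fun s' : ℝ => (s', x)) (g := fun z : ℝ × ℝ => f z.1 z.2)
        (hf s x hx) (by fun_prop)
    exact hc.eventually (lt_mem_nhds hfx)
  have h2 : ∀ᶠ s' in 𝓝 s, ∀ y ∈ Icc T x, 0 < g s' y :=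
    isCompact_Icc.eventually_forall_of_forall_eventually fun y hy =>
      (hg s y hy.1).eventually (lt_mem_nhds (hgx y hy))
  filter_upwards [h1, h2] with s' h1 h2
  exact ⟨x, hx, h1, h2⟩

theorem exists_pos_of_eventually {f g : ℝ → ℝ} {T x : ℝ} (hx : T ≤ x)
    (hg : ContinuousAt g x) (hgx : ∀ y ∈ Icc T x, 0 < g y) (hf : ∀ᶠ y in 𝓝[>] x, 0 < f y) :
    ∃ x' ≥ T, 0 < f x' ∧ ∀ y ∈ Icc T x', 0 < g y := by
  obtain ⟨ε, hε, h1⟩ := Metric.eventually_nhds_iff.1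
    (hg.eventually (lt_mem_nhds (hgx x ⟨hx, le_rfl⟩)))
  have h2 : ∀ᶠ y in 𝓝[>] x, y < x + ε :=
    eventually_nhdsWithin_of_eventually_nhds (gt_mem_nhds (by linarith))
  obtain ⟨x', ⟨h3, h4⟩, h5⟩ := ((hf.and h2).and self_mem_nhdsWithin).exists
  have h5' : x < x' := h5
  refine ⟨x', hx.trans h5'.le, h3, fun y hy => ?_⟩
  by_cases hyx : y ≤ x
  · exact hgx y ⟨hy.1, hyx⟩
  · exact h1 (by rw [Real.dist_eq, abs_lt]; constructor <;> linarith [hy.2])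

/-- If trajectories can leave the cone `f < 0 < g` only transversally through its two faces, and
both faces are used, then some trajectory stays in the cone. -/
theorem exists_forall_mem_cone {f g : ℝ → ℝ → ℝ} {T a b : ℝ} (hab : a ≤ b)
    (hf : ∀ s, ∀ x ≥ T, ContinuousAt (fun z : ℝ × ℝ => f z.1 z.2) (s, x))
    (hg : ∀ s, ∀ x ≥ T, ContinuousAt (fun z : ℝ × ℝ => g z.1 z.2) (s, x))
    (hT : ∀ s ∈ Icc a b, f s T < g s T)
    (hexit : ∀ s ∈ Icc a b, ∀ x ≥ T, (∀ y ∈ Icc T x, f s y ≤ 0 ∧ 0 ≤ g s y) →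
      (f s x = 0 → 0 < g s x ∧ ∀ᶠ y in 𝓝[>] x, 0 < f s y) ∧
      (g s x = 0 → f s x < 0 ∧ ∀ᶠ y in 𝓝[>] x, g s y < 0))
    (ha : 0 < f a T) (hb : g b T < 0) :
    ∃ s ∈ Icc a b, ∀ x ≥ T, f s x < 0 ∧ 0 < g s x := by
  by_contra! hcon
  set S₁ : Set ℝ := {s | ∃ x ≥ T, 0 < f s x ∧ ∀ y ∈ Icc T x, 0 < g s y} with hS₁
  set S₂ : Set ℝ := {s | ∃ x ≥ T, 0 < -g s x ∧ ∀ y ∈ Icc T x, 0 < -f s y} with hS₂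
  have ho₁ : IsOpen S₁ := isOpen_setOf_exists_forall_Icc hf hg
  have ho₂ : IsOpen S₂ := isOpen_setOf_exists_forall_Icc (f := fun s x => -g s x)
    (g := fun s x => -f s x) (fun s x hx => (hg s x hx).neg) (fun s x hx => (hf s x hx).neg)
  have hcover : Icc a b ⊆ S₁ ∪ S₂ := by
    intro s hs
    have hfc : ∀ x ≥ T, ContinuousAt (f s) x := fun x hx =>
      ContinuousAt.comp (f := fun y : ℝ => (s, y)) (g := fun z : ℝ × ℝ => f z.1 z.2)
        (hf s x hx) (by fun_prop)
    have hgc : ∀ x ≥ T, ContinuousAt (g s) x := fun x hx =>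
      ContinuousAt.comp (f := fun y : ℝ => (s, y)) (g := fun z : ℝ × ℝ => g z.1 z.2)
        (hg s x hx) (by fun_prop)
    set B : Set ℝ := {x | T ≤ x ∧ (f s x < 0 → g s x ≤ 0)} with hB
    obtain ⟨x₀, hx₀, hx₀'⟩ := hcon s hs
    have hBne : B.Nonempty := ⟨x₀, hx₀, hx₀'⟩
    have hBb : BddBelow B := ⟨T, fun x hx => hx.1⟩
    set x := sInf B with hxdef
    have hTx : T ≤ x := le_csInf hBne fun y hy => hy.1
    have hbefore : ∀ y, T ≤ y → y < x → f s y < 0 ∧ 0 < g s y := by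
      intro y hy hyx
      by_contra h
      exact (csInf_le hBb ⟨hy, fun h1 => not_lt.1 fun h2 => h ⟨h1, h2⟩⟩).not_gt hyx
    have hxB : f s x < 0 → g s x ≤ 0 := by
      intro h1
      by_contra! h2
      obtain ⟨ε, hε, h3⟩ := Metric.eventually_nhds_iff.1
        (((hfc x hTx).eventually (gt_mem_nhds h1)).and ((hgc x hTx).eventually (lt_mem_nhds h2)))
      obtain ⟨y, hyB, hy⟩ := exists_lt_of_csInf_lt hBne (show sInf B < x + ε by linarith)
      have hxy : x ≤ y := csInf_le hBb hyB
      have h4 := h3 (show dist y x < ε by rw [Real.dist_eq, abs_lt]; constructor <;> linarith)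
      exact (hyB.2 h4.1).not_gt h4.2
    rcases lt_or_ge 0 (f s T) with hfT | hfT
    · refine Or.inl ⟨T, le_rfl, hfT, fun y hy => ?_⟩
      rw [Icc_self] at hy
      rw [mem_singleton_iff.1 hy]
      exact hfT.trans (hT s hs)
    rcases lt_or_ge (g s T) 0 with hgT | hgT
    · refine Or.inr ⟨T, le_rfl, by linarith, fun y hy => ?_⟩
      rw [Icc_self] at hy
      rw [mem_singleton_iff.1 hy]
      linarith [hT s hs]
    have hx01 : f s x ≤ 0 ∧ 0 ≤ g s x := by
      rcases hTx.eq_or_lt with h | h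
      · rw [← h]; exact ⟨hfT, hgT⟩
      · have hev : ∀ᶠ y in 𝓝[<] x, f s y < 0 ∧ 0 < g s y := by
          filter_upwards [Ioo_mem_nhdsLT h] with y hy using hbefore y hy.1.le hy.2
        exact ⟨le_of_tendsto ((hfc x hTx).tendsto.mono_left nhdsWithin_le_nhds)
            (hev.mono fun y hy => hy.1.le),
          ge_of_tendsto ((hgc x hTx).tendsto.mono_left nhdsWithin_le_nhds)
            (hev.mono fun y hy => hy.2.le)⟩
    obtain ⟨he₁, he₂⟩ := hexit s hs x hTx fun y hy => by
      rcases hy.2.eq_or_lt with h | h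
      · rw [h]; exact hx01
      · exact ⟨(hbefore y hy.1 h).1.le, (hbefore y hy.1 h).2.le⟩
    rcases hx01.1.eq_or_lt with hfx | hfx
    · obtain ⟨h1, h2⟩ := he₁ hfx
      refine Or.inl (exists_pos_of_eventually hTx (hgc x hTx) (fun y hy => ?_) h2)
      rcases hy.2.eq_or_lt with h | h
      · rw [h]; exact h1
      · exact (hbefore y hy.1 h).2
    · obtain ⟨h1, h2⟩ := he₂ (le_antisymm (hxB hfx) hx01.2)
      refine Or.inr (exists_pos_of_eventually (g := fun y => -f s y) (f := fun y => -g s y) hTx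
        (hfc x hTx).neg (fun y hy => ?_) (h2.mono fun y hy => by linarith))
      rcases hy.2.eq_or_lt with h | h
      · rw [h]; linarith
      · linarith [(hbefore y hy.1 h).1]
  have hne₁ : (Icc a b ∩ S₁).Nonempty := by
    refine ⟨a, ⟨le_rfl, hab⟩, T, le_rfl, ha, fun y hy => ?_⟩
    rw [Icc_self] at hy
    rw [mem_singleton_iff.1 hy]
    exact ha.trans (hT a ⟨le_rfl, hab⟩)
  have hne₂ : (Icc a b ∩ S₂).Nonempty := by
    refine ⟨b, ⟨hab, le_rfl⟩, T, le_rfl, by linarith, fun y hy => ?_⟩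
    rw [Icc_self] at hy
    rw [mem_singleton_iff.1 hy]
    linarith [hT b ⟨hab, le_rfl⟩]
  obtain ⟨s, -, ⟨x, hx, h1, h2⟩, ⟨y, hy, h3, h4⟩⟩ :=
    isPreconnected_Icc S₁ S₂ ho₁ ho₂ hcover hne₁ hne₂
  rcases le_total x y with h | h
  · linarith [h4 x ⟨hx, h⟩]
  · linarith [h2 y ⟨hy, h⟩]

/-! ### Approximate Floquet solutions -/

/-- The periodic factor of an approximate solution `exp (-0.1219 x) * p x` of the linearized
equation at zero. -/
noncomputable def floquetMinus (x : ℝ) : ℝ :=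
  cos x - 0.6078 * sin x - 0.0366 * cos (3 * x) + 0.0179 * sin (3 * x)

/-- The periodic factor of an approximate solution `exp (0.1219 x) * p x` of the linearized
equation at zero. -/
noncomputable def floquetPlus (x : ℝ) : ℝ :=
  cos x + 0.6078 * sin x - 0.0366 * cos (3 * x) - 0.0179 * sin (3 * x)

noncomputable def floquetMinusDeriv (x : ℝ) : ℝ :=
  -sin x - 0.6078 * cos x + 0.1098 * sin (3 * x) + 0.0537 * cos (3 * x) -
    0.1219 * floquetMinus x

noncomputable def floquetPlusDeriv (x : ℝ) : ℝ :=
  -sin x + 0.6078 * cos x + 0.1098 * sin (3 * x) - 0.0537 * cos (3 * x) +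
    0.1219 * floquetPlus x

noncomputable def potential (x : ℝ) : ℝ := 1.1025 * (1 - cos (2 * x) / 2)

noncomputable def defectMinus (x : ℝ) : ℝ :=
  -cos x + 0.6078 * sin x + 0.3294 * cos (3 * x) - 0.1611 * sin (3 * x) -
    0.2438 * (floquetMinusDeriv x + 0.1219 * floquetMinus x) + 0.1219 ^ 2 * floquetMinus x +
    potential x * floquetMinus x

noncomputable def defectPlus (x : ℝ) : ℝ :=
  -cos x - 0.6078 * sin x + 0.3294 * cos (3 * x) + 0.1611 * sin (3 * x) +
    0.2438 * (floquetPlusDeriv x - 0.1219 * floquetPlus x) + 0.1219 ^ 2 * floquetPlus x +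
    potential x * floquetPlus x

theorem hasDerivAt_cos_mul (k x : ℝ) : HasDerivAt (fun x => cos (k * x)) (-k * sin (k * x)) x := by
  convert! ((hasDerivAt_id x).const_mul k).cos using 1
  simp; ring

theorem hasDerivAt_sin_mul (k x : ℝ) : HasDerivAt (fun x => sin (k * x)) (k * cos (k * x)) x := by
  convert! ((hasDerivAt_id x).const_mul k).sin using 1
  simp; ring

theorem hasDerivAt_floquetMinus (x : ℝ) :
    HasDerivAt floquetMinus (floquetMinusDeriv x + 0.1219 * floquetMinus x) x := by
  convert! (((hasDerivAt_cos x).sub ((hasDerivAt_sin x).const_mul 0.6078)).sub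
    ((hasDerivAt_cos_mul 3 x).const_mul 0.0366)).add ((hasDerivAt_sin_mul 3 x).const_mul 0.0179)
    using 1
  simp only [floquetMinusDeriv]; ring

theorem hasDerivAt_floquetPlus (x : ℝ) :
    HasDerivAt floquetPlus (floquetPlusDeriv x - 0.1219 * floquetPlus x) x := by
  convert! (((hasDerivAt_cos x).add ((hasDerivAt_sin x).const_mul 0.6078)).sub
    ((hasDerivAt_cos_mul 3 x).const_mul 0.0366)).sub ((hasDerivAt_sin_mul 3 x).const_mul 0.0179)
    using 1
  simp only [floquetPlusDeriv]; ring

theorem hasDerivAt_floquetMinusDeriv (x : ℝ) : HasDerivAt floquetMinusDeriv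
    (defectMinus x + 0.1219 * floquetMinusDeriv x - potential x * floquetMinus x) x := by
  convert! (((((hasDerivAt_sin x).neg).sub ((hasDerivAt_cos x).const_mul 0.6078)).add
    ((hasDerivAt_sin_mul 3 x).const_mul 0.1098)).add ((hasDerivAt_cos_mul 3 x).const_mul 0.0537)).sub
    ((hasDerivAt_floquetMinus x).const_mul 0.1219) using 1
  simp only [defectMinus]; ring

theorem hasDerivAt_floquetPlusDeriv (x : ℝ) : HasDerivAt floquetPlusDeriv
    (defectPlus x - 0.1219 * floquetPlusDeriv x - potential x * floquetPlus x) x := by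
  convert! (((((hasDerivAt_sin x).neg).add ((hasDerivAt_cos x).const_mul 0.6078)).add
    ((hasDerivAt_sin_mul 3 x).const_mul 0.1098)).sub ((hasDerivAt_cos_mul 3 x).const_mul 0.0537)).add
    ((hasDerivAt_floquetPlus x).const_mul 0.1219) using 1
  simp only [defectPlus]; ring

theorem abs_mul_cos_add_mul_sin_le {a b r : ℝ} (hr : 0 ≤ r) (h : a ^ 2 + b ^ 2 ≤ r ^ 2) (x : ℝ) :
    |a * cos x + b * sin x| ≤ r := by
  refine abs_le_of_sq_le_sq ?_ hr
  refine le_trans ?_ h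
  have h1 := sin_sq_add_cos_sq x
  have h2 : (a * cos x + b * sin x) ^ 2 + (a * sin x - b * cos x) ^ 2 =
      (a ^ 2 + b ^ 2) * (sin x ^ 2 + cos x ^ 2) := by ring
  rw [h1] at h2
  nlinarith [sq_nonneg (a * sin x - b * cos x)]

theorem abs_harmonics_le {a b c d r s t : ℝ} (hr : 0 ≤ r) (hs : 0 ≤ s) (h : a ^ 2 + b ^ 2 ≤ r ^ 2)
    (h' : c ^ 2 + d ^ 2 ≤ s ^ 2) (ht : r + s ≤ t) (x : ℝ) :
    |a * cos x + b * sin x + c * cos (3 * x) + d * sin (3 * x)| ≤ t := by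
  have h1 := abs_mul_cos_add_mul_sin_le hr h x
  have h2 := abs_mul_cos_add_mul_sin_le hs h' (3 * x)
  rw [show a * cos x + b * sin x + c * cos (3 * x) + d * sin (3 * x) =
    (a * cos x + b * sin x) + (c * cos (3 * x) + d * sin (3 * x)) by ring]
  linarith [abs_add_le (a * cos x + b * sin x) (c * cos (3 * x) + d * sin (3 * x))]

theorem abs_floquetMinus_le (x : ℝ) : |floquetMinus x| ≤ 1.2115 := by
  have := abs_harmonics_le (a := 1) (b := -0.6078) (c := -0.0366) (d := 0.0179) (r := 1.1703)
    (s := 0.0409) (t := 1.2115) (by norm_num) (by norm_num) (by norm_num) (by norm_num)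
    (by norm_num) x
  convert this using 2
  simp only [floquetMinus]; ring

theorem abs_floquetPlus_le (x : ℝ) : |floquetPlus x| ≤ 1.2115 := by
  have := abs_harmonics_le (a := 1) (b := 0.6078) (c := -0.0366) (d := -0.0179) (r := 1.1703)
    (s := 0.0409) (t := 1.2115) (by norm_num) (by norm_num) (by norm_num) (by norm_num)
    (by norm_num) x
  convert this using 2
  simp only [floquetPlus]; ring

theorem abs_floquetMinusDeriv_le (x : ℝ) : |floquetMinusDeriv x| ≤ 1.5 := by
  have := abs_harmonics_le (a := -0.6078) (b := -1) (c := 0.0537) (d := 0.1098) (r := 1.1703)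
    (s := 0.123) (t := 1.3) (by norm_num) (by norm_num) (by norm_num) (by norm_num)
    (by norm_num) x
  have h2 := abs_floquetMinus_le x
  rw [abs_le] at *
  simp only [floquetMinusDeriv]
  constructor <;> linarith

theorem abs_floquetPlusDeriv_le (x : ℝ) : |floquetPlusDeriv x| ≤ 1.5 := by
  have := abs_harmonics_le (a := 0.6078) (b := -1) (c := -0.0537) (d := 0.1098) (r := 1.1703)
    (s := 0.123) (t := 1.3) (by norm_num) (by norm_num) (by norm_num) (by norm_num)
    (by norm_num) x
  have h2 := abs_floquetPlus_le x
  rw [abs_le] at *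
  simp only [floquetPlusDeriv]
  constructor <;> linarith

theorem abs_floquet_combination_le (x : ℝ) :
    |floquetMinus x + 0.23 * floquetPlus x| ≤ 1.3637 ∧
    |floquetMinus x - 0.23 * floquetPlus x| ≤ 1.3637 := by
  constructor
  · have := abs_harmonics_le (a := 1.23) (b := -0.468006) (c := -0.045018) (d := 0.013783)
      (r := 1.3165) (s := 0.0472) (t := 1.3637) (by norm_num) (by norm_num) (by norm_num)
      (by norm_num) (by norm_num) x
    convert this using 2
    simp only [floquetMinus, floquetPlus]; ring
  · have := abs_harmonics_le (a := 0.77) (b := -0.747594) (c := -0.028182) (d := 0.022017)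
      (r := 1.3165) (s := 0.0472) (t := 1.3637) (by norm_num) (by norm_num) (by norm_num)
      (by norm_num) (by norm_num) x
    convert this using 2
    simp only [floquetMinus, floquetPlus]; ring

theorem abs_floquetMinus_add_abs_floquetPlus_le (x : ℝ) :
    |floquetMinus x| + 0.23 * |floquetPlus x| ≤ 1.3637 := by
  obtain ⟨h1, h2⟩ := abs_floquet_combination_le x
  rw [abs_le] at h1 h2
  rcases abs_cases (floquetMinus x) with h | h <;> rcases abs_cases (floquetPlus x) with h' | h' <;>
    linarith [h.1, h'.1]

theorem floquet_wronskian_ge (x : ℝ) :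
    1.29 ≤ floquetMinus x * floquetPlusDeriv x - floquetPlus x * floquetMinusDeriv x := by
  have h1 := sin_sq_add_cos_sq x
  have h3 := sin_sq_add_cos_sq (3 * x)
  have e2 : cos (2 * x) = cos (3 * x) * cos x + sin (3 * x) * sin x := by
    rw [← cos_sub]; ring_nf
  have e4 : cos (4 * x) = cos (3 * x) * cos x - sin (3 * x) * sin x := by
    rw [← cos_add]; ring_nf
  have e2' : cos (2 * x) = cos x ^ 2 - sin x ^ 2 := cos_two_mul' x
  have e6 : cos (6 * x) = cos (3 * x) ^ 2 - sin (3 * x) ^ 2 := by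
    rw [← cos_two_mul']; ring_nf
  have hb2 := abs_le.1 (abs_cos_le_one (2 * x))
  have hb4 := abs_le.1 (abs_cos_le_one (4 * x))
  have hb6 := abs_le.1 (abs_cos_le_one (6 * x))
  simp only [floquetMinusDeriv, floquetPlusDeriv, floquetMinus, floquetPlus]
  generalize cos x = c at *
  generalize sin x = s at *
  generalize cos (3 * x) = c3 at *
  generalize sin (3 * x) = s3 at *
  nlinarith

theorem abs_harmonics_five_le {a b c d e f r s t q : ℝ} (hr : 0 ≤ r) (hs : 0 ≤ s) (hq : 0 ≤ q)
    (h : a ^ 2 + b ^ 2 ≤ r ^ 2) (h' : c ^ 2 + d ^ 2 ≤ s ^ 2) (h'' : e ^ 2 + f ^ 2 ≤ q ^ 2)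
    (ht : r + s + q ≤ t) (x : ℝ) :
    |a * cos x + b * sin x + c * cos (3 * x) + d * sin (3 * x) + e * cos (5 * x) +
      f * sin (5 * x)| ≤ t := by
  have h1 := abs_harmonics_le hr hs h h' le_rfl x
  have h2 := abs_mul_cos_add_mul_sin_le hq h'' (5 * x)
  have h3 := abs_add_le (a * cos x + b * sin x + c * cos (3 * x) + d * sin (3 * x))
    (e * cos (5 * x) + f * sin (5 * x))
  rw [← add_assoc] at h3
  linarith

theorem defectMinus_eq (x : ℝ) : defectMinus x = 0.000004125 * cos x + 0.000010266542 * sin x -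
    0.000212421726 * cos (3 * x) - 0.000343627981 * sin (3 * x) + 0.010087875 * cos (5 * x) -
    0.0049336875 * sin (5 * x) ∧
    defectPlus x = 0.000004125 * cos x - 0.000010266542 * sin x -
    0.000212421726 * cos (3 * x) + 0.000343627981 * sin (3 * x) + 0.010087875 * cos (5 * x) +
    0.0049336875 * sin (5 * x) := by
  have hc := cos_add (2 * x) x
  have hc' := cos_sub (2 * x) x
  have hs := sin_add (2 * x) x
  have hs' := sin_sub (2 * x) x
  rw [show 2 * x + x = 3 * x by ring] at hc hs
  rw [show 2 * x - x = x by ring] at hc' hs'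
  have i1 : cos (2 * x) * cos x = (cos x + cos (3 * x)) / 2 := by linarith
  have i2 : cos (2 * x) * sin x = (sin (3 * x) - sin x) / 2 := by linarith
  have i3 : cos (2 * x) * cos (3 * x) = (cos x + cos (5 * x)) / 2 := by
    rw [show 5 * x = 3 * x + 2 * x by ring, cos_add]
    nth_rewrite 3 [show x = 3 * x - 2 * x by ring]
    rw [cos_sub]; ring
  have i4 : cos (2 * x) * sin (3 * x) = (sin x + sin (5 * x)) / 2 := by
    rw [show 5 * x = 3 * x + 2 * x by ring, sin_add]
    nth_rewrite 3 [show x = 3 * x - 2 * x by ring]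
    rw [sin_sub]; ring
  simp only [defectMinus, defectPlus, potential, floquetMinusDeriv, floquetPlusDeriv, floquetMinus,
    floquetPlus]
  constructor
  · linear_combination (-0.55125) * (i1 - 0.6078 * i2 - 0.0366 * i3 + 0.0179 * i4)
  · linear_combination (-0.55125) * (i1 + 0.6078 * i2 - 0.0366 * i3 - 0.0179 * i4)

theorem abs_defectPlus_le (x : ℝ) : |defectPlus x| ≤ 0.0117 := by
  have := abs_harmonics_five_le (a := 0.000004125) (b := -0.000010266542) (c := -0.000212421726)
    (d := 0.000343627981) (e := 0.010087875) (f := 0.0049336875) (r := 0.0000111) (s := 0.000405)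
    (q := 0.01123) (t := 0.0117) (by norm_num) (by norm_num) (by norm_num) (by norm_num)
    (by norm_num) (by norm_num) (by norm_num) x
  convert this using 2
  rw [(defectMinus_eq x).2]; ring

theorem abs_defect_combination_le (x : ℝ) :
    |defectMinus x + 0.23 * defectPlus x| ≤ 0.0134 ∧
    |defectMinus x - 0.23 * defectPlus x| ≤ 0.0134 := by
  rw [(defectMinus_eq x).1, (defectMinus_eq x).2]
  constructor
  · have := abs_harmonics_five_le (a := 0.000004125 * 1.23) (b := 0.000010266542 * 0.77)
      (c := -0.000212421726 * 1.23) (d := -0.000343627981 * 0.77) (e := 0.010087875 * 1.23)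
      (f := -0.0049336875 * 0.77) (r := 0.000015) (s := 0.0004)
      (q := 0.01298) (t := 0.0134) (by norm_num) (by norm_num) (by norm_num) (by norm_num)
      (by norm_num) (by norm_num) (by norm_num) x
    convert this using 2
    ring
  · have := abs_harmonics_five_le (a := 0.000004125 * 0.77) (b := 0.000010266542 * 1.23)
      (c := -0.000212421726 * 0.77) (d := -0.000343627981 * 1.23) (e := 0.010087875 * 0.77)
      (f := -0.0049336875 * 1.23) (r := 0.000015) (s := 0.0005)
      (q := 0.0099) (t := 0.0134) (by norm_num) (by norm_num) (by norm_num) (by norm_num)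
      (by norm_num) (by norm_num) (by norm_num) x
    convert this using 2
    ring

/-! ### The invariant cone -/

theorem abs_face_perturbation_lt {Z u q r D : ℝ} (hZ : 0 < Z) (hZ' : Z ≤ 0.17) (hD : 1.29 ≤ D)
    (hq : |q| ≤ 1.3637) (hr : |r| ≤ 0.0134) (hu : u * D = Z * q) :
    |r * u + 0.826875 * u ^ 3 * q| < 2 * 0.23 * 0.1219 * Z := by
  have hD0 : 0 < D := by linarith
  have hub : |u| ≤ 1.3637 / 1.29 * Z := by
    have h1 : |u| * D = Z * |q| := by
      have := congrArg abs hu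
      rwa [abs_mul, abs_mul, abs_of_pos hZ, abs_of_pos hD0] at this
    have h2 : |u| * 1.29 ≤ |u| * D := by gcongr
    have h3 : Z * |q| ≤ Z * 1.3637 := by gcongr
    rw [div_mul_eq_mul_div, le_div_iff₀ (by norm_num)]
    linarith
  have h1 : |r * u| ≤ 0.0134 * (1.3637 / 1.29 * Z) := by rw [abs_mul]; gcongr
  have h2 : |0.826875 * u ^ 3 * q| ≤ 0.826875 * (1.3637 / 1.29 * Z) ^ 3 * 1.3637 := by
    rw [abs_mul, abs_mul, abs_pow, abs_of_pos (by norm_num : (0 : ℝ) < 0.826875)]; gcongr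
  have h3 : Z ^ 2 ≤ 0.17 ^ 2 := by gcongr
  have h4 : Z * Z ^ 2 ≤ Z * 0.17 ^ 2 := by gcongr
  have := abs_add_le (r * u) (0.826875 * u ^ 3 * q)
  nlinarith

theorem decay_rate_le {X Z u pm pp r D : ℝ} (hZ : 0 ≤ Z) (hZ' : Z ≤ 0.17) (hD : 1.29 ≤ D)
    (hX : |X| ≤ 0.23 * Z) (hp : |pm| + 0.23 * |pp| ≤ 1.3637) (hpp : |pp| ≤ 1.2115)
    (hr : |r| ≤ 0.0117) (hu : u * D = pp * X + pm * Z) :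
    |u| ≤ 1.06 * Z ∧ -0.1219 * Z + r * u + 0.826875 * u ^ 3 * pp ≤ -0.07 * Z := by
  have hD0 : 0 < D := by linarith
  have hub : |u| ≤ 1.3637 / 1.29 * Z := by
    have h1 : |u| * D ≤ |pp| * |X| + |pm| * Z := by
      rw [← abs_of_pos hD0, ← abs_mul, hu]
      refine (abs_add_le _ _).trans ?_
      rw [abs_mul, abs_mul, abs_of_nonneg hZ]
    have h2 : |u| * 1.29 ≤ |u| * D := by gcongr
    have h3 : |pp| * |X| ≤ |pp| * (0.23 * Z) := by gcongr
    have h4 : (|pm| + 0.23 * |pp|) * Z ≤ 1.3637 * Z := by gcongr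
    rw [div_mul_eq_mul_div, le_div_iff₀ (by norm_num)]
    linarith
  have h1 : |r * u| ≤ 0.0117 * (1.3637 / 1.29 * Z) := by rw [abs_mul]; gcongr
  have h2 : |0.826875 * u ^ 3 * pp| ≤ 0.826875 * (1.3637 / 1.29 * Z) ^ 3 * 1.2115 := by
    rw [abs_mul, abs_mul, abs_pow, abs_of_pos (by norm_num : (0 : ℝ) < 0.826875)]; gcongr
  have h3 : Z ^ 2 ≤ 0.17 ^ 2 := by gcongr
  have h4 : Z * Z ^ 2 ≤ Z * 0.17 ^ 2 := by gcongr
  have h5 := le_abs_self (r * u)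
  have h6 := le_abs_self (0.826875 * u ^ 3 * pp)
  constructor <;> nlinarith

/-- The coordinate of a trajectory, in the Floquet frame, along the growing solution. -/
noncomputable def unstableCoord (s x : ℝ) : ℝ :=
  floquetMinus x * (traj s x).2 - floquetMinusDeriv x * (traj s x).1

/-- The coordinate of a trajectory, in the Floquet frame, along the decaying solution. -/
noncomputable def stableCoord (s x : ℝ) : ℝ :=
  floquetPlusDeriv x * (traj s x).1 - floquetPlus x * (traj s x).2

theorem differentiable_stableCoord (s : ℝ) : Differentiable ℝ (stableCoord s) := fun x =>
  (((hasDerivAt_floquetPlusDeriv x).mul (hasDerivAt_traj_fst s x)).sub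
    ((hasDerivAt_floquetPlus x).mul (hasDerivAt_traj_snd s x))).differentiableAt

theorem hasDerivAt_unstableCoord {s x : ℝ} (hu : |(traj s x).1| ≤ 2) (hv : |(traj s x).2| ≤ 2) :
    HasDerivAt (unstableCoord s) (0.1219 * unstableCoord s x -
      (defectMinus x * (traj s x).1 + 0.826875 * (traj s x).1 ^ 3 * floquetMinus x)) x := by
  convert! ((hasDerivAt_floquetMinus x).mul (hasDerivAt_traj_snd s x)).sub
    ((hasDerivAt_floquetMinusDeriv x).mul (hasDerivAt_traj_fst s x)) using 1
  rw [clip_of_abs_le hu, clip_of_abs_le hv]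
  simp only [unstableCoord, potential]; ring

theorem hasDerivAt_stableCoord {s x : ℝ} (hu : |(traj s x).1| ≤ 2) (hv : |(traj s x).2| ≤ 2) :
    HasDerivAt (stableCoord s) (-0.1219 * stableCoord s x + defectPlus x * (traj s x).1 +
      0.826875 * (traj s x).1 ^ 3 * floquetPlus x) x := by
  convert! ((hasDerivAt_floquetPlusDeriv x).mul (hasDerivAt_traj_fst s x)).sub
    ((hasDerivAt_floquetPlus x).mul (hasDerivAt_traj_snd s x)) using 1
  rw [clip_of_abs_le hu, clip_of_abs_le hv]
  simp only [stableCoord, potential]; ring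

theorem traj_fst_mul_wronskian (s x : ℝ) :
    (traj s x).1 *
        (floquetMinus x * floquetPlusDeriv x - floquetPlus x * floquetMinusDeriv x) =
      floquetPlus x * unstableCoord s x + floquetMinus x * stableCoord s x := by
  simp only [unstableCoord, stableCoord]; ring

theorem traj_snd_mul_wronskian (s x : ℝ) :
    (traj s x).2 *
        (floquetMinus x * floquetPlusDeriv x - floquetPlus x * floquetMinusDeriv x) =
      floquetPlusDeriv x * unstableCoord s x + floquetMinusDeriv x * stableCoord s x := by
  simp only [unstableCoord, stableCoord]; ring

theorem bounds_of_mem_cone {s x : ℝ} (hX : |unstableCoord s x| ≤ 0.23 * stableCoord s x)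
    (hZ : stableCoord s x ≤ 0.17) :
    |(traj s x).1| ≤ 1.06 * stableCoord s x ∧ |(traj s x).2| ≤ 1.5 * stableCoord s x ∧
      deriv (stableCoord s) x ≤ -0.07 * stableCoord s x := by
  have hD := floquet_wronskian_ge x
  have hZ0 : 0 ≤ stableCoord s x := by linarith [abs_nonneg (unstableCoord s x)]
  obtain ⟨h1, h2⟩ := decay_rate_le hZ0 hZ hD hX (abs_floquetMinus_add_abs_floquetPlus_le x)
    (abs_floquetPlus_le x) (abs_defectPlus_le x) (traj_fst_mul_wronskian s x)
  have h3 : |(traj s x).2| ≤ 1.5 * stableCoord s x := by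
    have := congrArg abs (traj_snd_mul_wronskian s x)
    rw [abs_mul, abs_of_pos (by linarith :
      0 < floquetMinus x * floquetPlusDeriv x - floquetPlus x * floquetMinusDeriv x)] at this
    have h4 := abs_add_le (floquetPlusDeriv x * unstableCoord s x)
      (floquetMinusDeriv x * stableCoord s x)
    rw [abs_mul, abs_mul, abs_of_nonneg hZ0] at h4
    have h5 : |floquetPlusDeriv x| * |unstableCoord s x| ≤ 1.5 * (0.23 * stableCoord s x) := by
      gcongr; exact abs_floquetPlusDeriv_le x
    have h6 : |floquetMinusDeriv x| * stableCoord s x ≤ 1.5 * stableCoord s x := by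
      gcongr; exact abs_floquetMinusDeriv_le x
    have h7 := mul_le_mul_of_nonneg_left hD (abs_nonneg (traj s x).2)
    linarith
  refine ⟨h1, h3, ?_⟩
  rw [(hasDerivAt_stableCoord (by linarith) (by linarith)).deriv]
  exact h2

theorem stableCoord_le_of_forall_mem_cone {s T x : ℝ} (hT : stableCoord s T ≤ 0.17)
    (h : ∀ y ∈ Icc T x, |unstableCoord s y| ≤ 0.23 * stableCoord s y) :
    ∀ y ∈ Icc T x, stableCoord s y ≤ 0.17 := by
  have hd := differentiable_stableCoord s
  refine image_le_of_deriv_right_lt_deriv_boundary' (f' := deriv (stableCoord s)) (B' := fun _ => 0)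
    hd.continuous.continuousOn (fun y _ => (hd y).hasDerivAt.hasDerivWithinAt) hT
    continuousOn_const (fun y _ => hasDerivWithinAt_const _ _ _) fun y hy hy' => ?_
  linarith [(bounds_of_mem_cone (h y ⟨hy.1, hy.2.le⟩) hy'.le).2.2]

theorem eventually_pos_of_hasDerivAt_pos {f : ℝ → ℝ} {f' x : ℝ} (hf : HasDerivAt f f' x)
    (h0 : f x = 0) (h : 0 < f') : ∀ᶠ y in 𝓝[>] x, 0 < f y := by
  have h1 := eventually_nhdsWithin_sign_eq_of_deriv_pos (by rwa [hf.deriv]) h0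
  filter_upwards [h1.filter_mono nhdsWithin_le_nhds, self_mem_nhdsWithin] with y hy hy'
  rwa [sign_pos (sub_pos.2 hy'), sign_eq_one_iff] at hy

theorem stableCoord_pos {s x : ℝ} (hs : s ≠ 0)
    (hX : |unstableCoord s x| ≤ 0.23 * stableCoord s x) (hZ : stableCoord s x ≤ 0.17) :
    0 < stableCoord s x := by
  refine lt_of_le_of_ne (by linarith [abs_nonneg (unstableCoord s x)]) fun h => ?_
  obtain ⟨h1, h2, -⟩ := bounds_of_mem_cone hX hZ
  rw [← h, mul_zero] at h1 h2
  exact traj_ne_zero hs x (Prod.ext (abs_nonpos_iff.1 h1) (abs_nonpos_iff.1 h2))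

theorem exists_mem_cone {T a b : ℝ} (hab : a ≤ b) (hT0 : 0 < T) (ha0 : 0 < a)
    (hT : ∀ s ∈ Icc a b, 0 < stableCoord s T ∧ stableCoord s T ≤ 0.17)
    (ha : 0.23 * stableCoord a T < unstableCoord a T)
    (hb : unstableCoord b T < -0.23 * stableCoord b T) :
    ∃ s ∈ Icc a b, ∀ x ≥ T, |unstableCoord s x| ≤ 0.23 * stableCoord s x := by
  have hc : ∀ s, ∀ x ≥ T, ContinuousAt (fun z : ℝ × ℝ => unstableCoord z.1 z.2) (s, x) ∧
      ContinuousAt (fun z : ℝ × ℝ => stableCoord z.1 z.2) (s, x) := by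
    intro s x hx
    have h1 := continuousAt_traj_uncurry s (hT0.trans_le hx)
    have h2 {p : ℝ → ℝ} {p' : ℝ} (hp : HasDerivAt p p' x) :
        ContinuousAt (fun z : ℝ × ℝ => p z.2) (s, x) :=
      hp.continuousAt.comp (f := Prod.snd) (x := (s, x)) continuousAt_snd
    exact ⟨((h2 (hasDerivAt_floquetMinus x)).mul h1.snd).sub
        ((h2 (hasDerivAt_floquetMinusDeriv x)).mul h1.fst),
      ((h2 (hasDerivAt_floquetPlusDeriv x)).mul h1.fst).sub
        ((h2 (hasDerivAt_floquetPlus x)).mul h1.snd)⟩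
  suffices hexit : ∃ s ∈ Icc a b, ∀ x ≥ T, unstableCoord s x - 0.23 * stableCoord s x < 0 ∧
      0 < unstableCoord s x + 0.23 * stableCoord s x by
    obtain ⟨s, hs, h⟩ := hexit
    exact ⟨s, hs, fun x hx => abs_le.2 ⟨by linarith [(h x hx).2], by linarith [(h x hx).1]⟩⟩
  refine exists_forall_mem_cone
    (f := fun s x => unstableCoord s x - 0.23 * stableCoord s x)
    (g := fun s x => unstableCoord s x + 0.23 * stableCoord s x) hab
    (fun s x hx => (hc s x hx).1.sub ((hc s x hx).2.const_mul 0.23))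
    (fun s x hx => (hc s x hx).1.add ((hc s x hx).2.const_mul 0.23))
    (fun s hs => by linarith [(hT s hs).1]) ?_ (by linarith) (by linarith)
  intro s hs x hx hcone
  have hcone' : ∀ y ∈ Icc T x, |unstableCoord s y| ≤ 0.23 * stableCoord s y := fun y hy =>
    abs_le.2 ⟨by linarith [(hcone y hy).2], by linarith [(hcone y hy).1]⟩
  have hX := hcone' x ⟨hx, le_rfl⟩
  have hZ := stableCoord_le_of_forall_mem_cone (hT s hs).2 hcone' x ⟨hx, le_rfl⟩
  have hZ0 := stableCoord_pos (ha0.trans_le hs.1).ne' hX hZ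
  obtain ⟨hu, hv, -⟩ := bounds_of_mem_cone hX hZ
  have hX' := hasDerivAt_unstableCoord (s := s) (x := x) (by linarith) (by linarith)
  have hZ' := hasDerivAt_stableCoord (s := s) (x := x) (by linarith) (by linarith)
  have hD := floquet_wronskian_ge x
  have huD := traj_fst_mul_wronskian s x
  constructor
  · intro h0
    have h0' : unstableCoord s x = 0.23 * stableCoord s x := by linarith
    refine ⟨by linarith, eventually_pos_of_hasDerivAt_pos (hX'.sub (hZ'.const_mul 0.23)) h0 ?_⟩
    have := (abs_lt.1 (abs_face_perturbation_lt hZ0 hZ hD (abs_floquet_combination_le x).1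
      (abs_defect_combination_le x).1 (by rw [huD, h0']; ring))).2
    rw [h0']
    linarith
  · intro h0
    have h0' : unstableCoord s x = -0.23 * stableCoord s x := by linarith
    refine ⟨by linarith, (eventually_pos_of_hasDerivAt_pos (hX'.add (hZ'.const_mul 0.23)).neg
      (neg_eq_zero.2 h0) ?_).mono fun y hy => neg_pos.1 hy⟩
    have := (abs_lt.1 (abs_face_perturbation_lt hZ0 hZ hD (abs_floquet_combination_le x).2
      (abs_defect_combination_le x).2 (by rw [huD, h0']; ring))).1
    rw [h0']
    linarith

theorem tendsto_traj_of_mem_cone {s T : ℝ} (hT : stableCoord s T ≤ 0.17)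
    (h : ∀ x ≥ T, |unstableCoord s x| ≤ 0.23 * stableCoord s x) :
    (∀ x ≥ T, |(traj s x).1| ≤ 2 ∧ |(traj s x).2| ≤ 2) ∧
      Tendsto (traj s) atTop (𝓝 (0, 0)) := by
  have hZ : ∀ x ≥ T, stableCoord s x ≤ 0.17 := fun x hx =>
    stableCoord_le_of_forall_mem_cone hT (fun y hy => h y hy.1) x ⟨hx, le_rfl⟩
  have hb := fun x hx => bounds_of_mem_cone (h x hx) (hZ x hx)
  refine ⟨fun x hx => ⟨by linarith [hZ x hx, hb x hx], by linarith [hZ x hx, hb x hx]⟩, ?_⟩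
  have hd := differentiable_stableCoord s
  have hanti : AntitoneOn (fun x => stableCoord s x * exp (0.07 * x)) (Ici T) := by
    have he : ∀ x, HasDerivAt (fun x => stableCoord s x * exp (0.07 * x))
        (deriv (stableCoord s) x * exp (0.07 * x) +
          stableCoord s x * (exp (0.07 * x) * (0.07 * 1))) x := fun x =>
      (hd x).hasDerivAt.mul (((hasDerivAt_id x).const_mul 0.07).exp)
    refine antitoneOn_of_deriv_nonpos (convex_Ici T)
      (fun x _ => (he x).continuousAt.continuousWithinAt)
      (fun x _ => (he x).differentiableAt.differentiableWithinAt) fun x hx => ?_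
    rw [interior_Ici] at hx
    rw [(he x).deriv]
    have := (hb x (le_of_lt hx)).2.2
    have := exp_pos (0.07 * x)
    nlinarith
  have hlim : Tendsto (fun x => 1.5 * (stableCoord s T * exp (0.07 * T) * exp (-(0.07 * x))))
      atTop (𝓝 0) := by
    have h1 : Tendsto (fun x : ℝ => exp (-(0.07 * x))) atTop (𝓝 0) :=
      tendsto_exp_neg_atTop_nhds_zero.comp (tendsto_id.const_mul_atTop (by norm_num))
    simpa using (h1.const_mul (stableCoord s T * exp (0.07 * T))).const_mul 1.5
  have hle : ∀ x ≥ T, stableCoord s x ≤ stableCoord s T * exp (0.07 * T) * exp (-(0.07 * x)) := by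
    intro x hx
    have := hanti self_mem_Ici hx hx
    rwa [exp_neg, ← div_eq_mul_inv, le_div_iff₀ (exp_pos _)]
  refine Tendsto.prodMk_nhds (mx := fun x => (traj s x).1) (my := fun x => (traj s x).2) ?_ ?_ <;>
    refine squeeze_zero_norm' ?_ hlim <;>
    filter_upwards [eventually_ge_atTop T] with x hx <;>
    rw [Real.norm_eq_abs] <;>
    linarith [hle x hx, hb x hx, abs_nonneg (traj s x).1, abs_nonneg (traj s x).2]

/-! ### Entering the cone -/

def finalEndpoint : Endpoint :=
  ⟨[11329266267, -4507236218, -197528182, -6131424],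
    [-3039650755, -1062474951, -78241712, 61362], 34001000000, 231017828⟩

theorem floquet_values_six_pi :
    floquetMinus (π / 4 * 24) = 0.9634 ∧ floquetPlus (π / 4 * 24) = 0.9634 ∧
      floquetMinusDeriv (π / 4 * 24) = -0.67153846 ∧
      floquetPlusDeriv (π / 4 * 24) = 0.67153846 := by
  have h (n : ℕ) : cos (n * (2 * π)) = 1 ∧ sin (n * (2 * π)) = 0 :=
    ⟨cos_nat_mul_two_pi n, by simpa using sin_add_nat_mul_two_pi 0 n⟩
  have h1 : π / 4 * 24 = (3 : ℕ) * (2 * π) := by push_cast; ring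
  have h3 : 3 * (π / 4 * 24) = (9 : ℕ) * (2 * π) := by push_cast; ring
  simp only [floquetMinusDeriv, floquetPlusDeriv, floquetMinus, floquetPlus, h3, (h 9).1, (h 9).2]
  simp only [h1, (h 3).1, (h 3).2]
  norm_num

theorem coord_bounds_of_near {s ς : ℝ} (hς : |ς| ≤ 1)
    (h : Near s ς (π / 4 * 24) finalEndpoint) :
    0 < stableCoord s (π / 4 * 24) ∧ stableCoord s (π / 4 * 24) ≤ 0.17 ∧
      (ς = -1 → 0.23 * stableCoord s (π / 4 * 24) < unstableCoord s (π / 4 * 24)) ∧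
      (ς = 1 → unstableCoord s (π / 4 * 24) < -0.23 * stableCoord s (π / 4 * 24)) := by
  obtain ⟨e1, e2, e3, e4⟩ := floquet_values_six_pi
  simp only [stableCoord, unstableCoord, e1, e2, e3, e4]
  simp only [Near, finalEndpoint, evp] at h
  generalize (traj s (π / 4 * 24)).1 = u at *
  generalize (traj s (π / 4 * 24)).2 = v at *
  push_cast at h
  have hw := abs_le.1 (abs_le_of_sq_le_sq (a := π / 8 * v - _) (le_trans
    (le_add_of_nonneg_right (by positivity)) h) (by norm_num))
  have hu := abs_le.1 (abs_le_of_sq_le_sq ((mul_pow _ _ 2).trans_le (le_trans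
    (le_add_of_nonneg_left (sq_nonneg _)) h)) (by norm_num))
  obtain ⟨h7, h8⟩ := abs_le.1 hς
  have hs2 : ς ^ 2 ≤ 1 := by nlinarith
  have hs2' := sq_nonneg ς
  have hs3 : ς ^ 3 ≤ 1 ∧ -1 ≤ ς ^ 3 := by constructor <;> nlinarith
  obtain ⟨h1, h2⟩ := hu
  obtain ⟨h3, h4⟩ := hw
  ring_nf at h1 h2 h3 h4
  have hv : |v| ≤ 2 := by
    have h5 : |π * v| ≤ 2 * 3 := abs_le.2 ⟨by linarith, by linarith⟩
    rw [abs_mul, abs_of_pos pi_pos] at h5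
    have := mul_le_mul_of_nonneg_right pi_gt_three.le (abs_nonneg v)
    linarith
  have hπ : |π * v - 3.141592 * v| ≤ 0.000002 := by
    have h1 : |π - 3.141592| ≤ 0.000001 :=
      abs_le.2 ⟨by linarith [pi_gt_d6], by linarith [pi_lt_d6]⟩
    rw [← sub_mul, abs_mul]
    have h2 := mul_le_mul h1 hv (abs_nonneg v) (by norm_num)
    linarith
  obtain ⟨h5, h6⟩ := abs_le.1 hπ
  refine ⟨by linarith, by linarith, fun h => ?_, fun h => ?_⟩
  · subst h; linarith
  · subst h; linarith

/-- Approximate trajectories on the 24 intervals of length `π / 4` covering `[0, 6 π]`. -/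
def solitonPieces : List Piece := [
  ⟨[[65857900730, -10753598347, -5440351201, -23846351, 41330247, 25176012, 1645528, -978563,
  -52092, 22061, 1286, -374, -60, 4, 3], [1036727357, -318358531, -142979030, 15840229, 3485821,
  -313321, -68921, -527, 3378, 642, -155, -39, 5], [-1807750, -3322821, -1104590, 501516, 59762,
  -34524, -1836, 1546, 96, -40, -6], [-9111, -14762, -1126, 5002, -165, -650, 41, 48, -3]],
  52481000000, 63, 3293, 6275⟩,
  ⟨[[23843840479, -29588090002, -2830023565, 1054487691, 146102963, -19363623, -5366564, 369111,
  89675, -8623, 910, 384, -97, -18, 3], [-2932557, -623303348, 369325, 26162862, -356769, -23829,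
  80920, -18853, -6871, 630, 320, -11, -9], [-8927833, -2245316, 1124363, 83637, -46770, 24012,
  2414, -1669, -105, 53, 1], [-19462, 5930, 2427, -1955, 812, 484, -79, -29, 4]], 50162000000,
  3349, 6306, 12572⟩,
  ⟨[[-36774958779, -25915111579, 4548608413, 928064974, -186881041, -22926975, 6207601, 812670,
  -129886, -31883, 775, 1261, 66, -46, -4], [-1043627499, -318363988, 147081228, 19426842,
  -3263883, -906286, -15241, 52798, 4401, -2531, -284, 94, 15], [-8290894, 3409227, 1934573,
  211125, -41648, -34656, -1551, 2253, 176, -94, -13], [7295, 33220, 18392, 3048, -2090, -775, 83,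
  58, 2]], 50162000000, 6400, 15720, 31339⟩,
  ⟨[[-66255001723, -3031520299, 5495315953, -380950706, -34855658, 32948690, -2604977, -1182318,
  127809, 25758, -5197, -284, 201, -8, -7], [-1012293859, 345306922, 140625103, -21362275,
  -3095810, 954341, 362, -46810, 4155, 1847, -328, -50, 17], [6360109, 10228460, 415093, -715393,
  -37374, 38355, 95, -1922, 164, 73, -16], [125060, 51228, -27077, -11106, 2542, 1062, -179, -59,
  11]], 50162000000, 15945, 27820, 55461⟩,
  ⟨[[-53165089591, 15033406299, 3879742522, -127972885, -9196079, -24905236, -1744573, 933855,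
  33311, -13787, -150, -25, 21, 6, -2], [46594390, 614484929, -5079613, -22221666, 761777, -111969,
  -15822, 13784, -2332, -120, 168, -8, -5], [23206301, 4587020, -2527690, -93575, 90345, -15621,
  -2924, 588, 28, 8, 2], [89309, -71689, -7538, 12409, -626, -1037, 62, 38, -3]], 46650000000,
  27900, 37128, 79589⟩,
  ⟨[[-9537947890, 26815321762, 1103017453, -969006852, -119843579, 20043099, 6152616, -320997,
  -150900, -1940, 1183, 179, 62, 3, -3], [1086311513, 344077906, -126886817, -18401494, 938636,
  352196, 98400, 7671, -3029, -1173, -38, 52, 7], [22365839, -5258095, -2397161, -54613, -29270,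
  14559, 7017, -201, -332, -33, 7], [-20175, -30507, 3048, -9375, -859, 1115, 110, -42, -7]],
  46650000000, 37201, 52029, 111531⟩,
  ⟨[[39791444374, 18255596951, -4980305210, -571386649, 211672321, 13775371, -8329254, -531845,
  265662, 23744, -7399, -1119, 208, 50, -6], [1151982200, -309080313, -167440991, 13368692,
  6283192, -226788, -288270, -6589, 14195, 954, -625, -62, 25], [2154760, -14373303, -1323220,
  719585, 145167, -29970, -12082, 1325, 722, -47, -37], [-121952, -72670, 4200, 14468, 1528, -1615,
  -201, 104, 16]], 46650000000, 52221, 84330, 180772⟩,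
  ⟨[[55108161542, -2201188348, -4095457854, 516560670, -17492438, -28733893, 4588926, 766607,
  -187460, -3402, 5660, -615, -130, 35, 1], [48456094, -680295681, -5477561, 26090161, -3105280,
  -279528, 248653, -9722, -10121, 1256, 251, -75, -1], [-25236491, -10018602, 2850302, 163095,
  -179442, 17056, 8701, -1683, -197, 103, -4], [-160636, 47570, 20736, -15052, -2508, 1345, 63,
  -76, 8]], 46650000000, 84529, 117823, 252569⟩,
  ⟨[[37603434677, -14197448854, -2405477109, 92182819, 6472079, 24120821, 670005, -796938, -16440,
  6472, 653, 215, -38, -6, 1], [-1171113251, -474401411, 96031752, 14209407, 825664, 195748,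
  -132390, -6657, 3513, -296, -33, 13, 0], [-34559178, -136758, 1847414, -101851, 91286, 10787,
  -4710, -205, -18, -8, 6], [-103108, -34080, -39524, 4578, 4563, -150, -133, -2, -2]],
  40610000000, 117935, 136618, 336415⟩,
  ⟨[[1140414030, -20802039114, -131231355, 789062311, 84546419, -22050740, -5253199, 520108,
  165687, -2513, -3461, -267, 31, 9, 1], [-1611223189, 96813014, 185435700, 8476443, -4191419,
  -877434, 30616, 30828, 3189, -181, -201, -33, 5], [-26781803, 8814700, 3025691, 211046, -113306,
  -41962, 1924, 2190, 186, -65, -16], [-233544, -30334, 51664, 13019, -4528, -1115, 188, 73, 1]],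
  40610000000, 136703, 210235, 517693⟩,
  ⟨[[-34261349798, -11547915529, 4198701737, 259760921, -180032763, -1423971, 7404884, -71987,
  -250279, 3868, 7628, -72, -241, -2, 8], [-696791890, 757309008, 95821000, -36681725, -2546459,
  1527333, 112445, -65548, -6561, 2535, 326, -99, -14], [1888338, 17799113, 58492, -1005354, 30338,
  66399, -2067, -3689, 129, 175, -7], [-71922, 159310, 10323, -14837, 3170, 1451, -331, -87, 22]],
  40610000000, 210443, 362953, 893753⟩,
  ⟨[[-41000987670, 3664232905, 2692630394, -429011657, 40424650, 18162902, -4300653, -308856,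
  138406, -7871, -2678, 658, 13, -22, 2], [914320213, 732891135, -79645111, -12334431, 3933524,
  -832941, -160590, 47534, 1940, -1576, 146, 34, -10], [31786127, 10633899, -2113239, 333047,
  82946, -45680, -811, 1698, -242, -26, 17], [240615, 163267, 19751, 9612, -1454, -952, 138, 8,
  -11]], 40610000000, 363109, 480213, 1182500⟩,
  ⟨[[-25390945204, 11185838823, 1499707281, -51092951, -11469760, -18990377, 4734, 587352, 13335,
  -3837, -1065, -181, 39, 5, -1], [1994807008, 315262577, -134221610, -15542507, -2557548, 300009,
  211552, -4397, -3843, -6, -10, 5, 1], [47234180, 5539244, -1245622, -405009, -177317, 5846, 7028,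
  477, -3, -32, -6], [677539, 258944, -4678, -21724, -4476, 339, 177, 27, 0]], 36649000000, 480297,
  586442, 1600159⟩,
  ⟨[[1855270615, 14947795246, -213517685, -588249612, -53166420, 19476468, 3663641, -555793,
  -131400, 7774, 3659, 63, -77, -7, 1], [1944776414, -431261393, -223904005, 560316, 7693634,
  833552, -227054, -42966, 2904, 1271, 104, -18, -7], [47929291, -8044600, -5652360, -425962,
  268120, 49691, -10173, -3004, 156, 133, 6], [955939, -94959, -163570, -10724, 9678, 1255, -437,
  -103, 12]], 36649000000, 586589, 1115948, 3044962⟩,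
  ⟨[[26100575989, 7246637755, -3116631634, -104047762, 131003120, -3628426, -5274485, 292538,
  169291, -13327, -4703, 472, 131, -15, -4], [322295853, -1064055042, -41284596, 47192160,
  -1410566, -1929717, 119309, 78288, -4348, -2742, 147, 97, -5], [10771877, -26066363, -1431685,
  1281110, -95242, -75279, 9621, 3374, -580, -118, 30], [185397, -574741, -27428, 32547, -5259,
  -1769, 520, 66, -32]], 36649000000, 1116166, 2295456, 6263353⟩,
  ⟨[[29007800270, -3322245344, -1749724080, 306928454, -38188262, -10892743, 3191030, 116507,
  -86927, 7752, 1104, -431, 14, 11, -1], [-1662291270, -813622366, 118103849, 4146491, -3010671,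
  1403281, 69279, -54434, 1817, 993, -214, 0, 8], [-39900012, -22834183, 1301716, -263945, -49989,
  55143, 493, -1342, 212, -11, -11], [-919867, -503074, 21041, -5358, 1153, 1389, -91, -13, 6]],
  36649000000, 2295544, 3069927, 8376565⟩,
  ⟨[[17061486120, -8136166452, -969265688, 29890785, 11826664, 13618447, -198150, -414127, -10903,
  2878, 990, 122, -32, -4, 0], [-2788968517, -283413087, 168794039, 22725844, 3764940, -752939,
  -279688, 9373, 5546, 374, -14, -21, -1], [-81607446, -18333344, 2400678, 1099061, 278262, -13728,
  -12558, -1053, 130, 66, 7], [-1828606, -356091, 100434, 39848, 6540, -950, -416, -36, 7]],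
  34743000000, 3070025, 3894566, 11209643⟩,
  ⟨[[-2289664283, -10409205109, 263537070, 417609698, 33147423, -14941304, -2421781, 462297, 92161,
  -8491, -2863, 57, 74, 2, -1], [-2477813621, 681446801, 285358432, -5909983, -11243605, -775912,
  401011, 48160, -9189, -1853, 82, 51, 3], [-96734578, 9678219, 11409359, 777184, -499103, -75060,
  19487, 4463, -486, -205, 4], [-1773944, 575052, 322283, -5063, -19676, -1236, 988, 138, -36]],
  34743000000, 3894813, 8421122, 24238328⟩,
  ⟨[[-18739906297, -4673656592, 2198269568, 42267909, -90653529, 4218411, 3557297, -285127,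
  -108110, 12440, 2704, -434, -64, 13, 1], [-196774474, 1415984981, 23963648, -58809194, 3951754,
  2280739, -275750, -83683, 10786, 2449, -377, -70, 13], [-34302962, 47536912, 4191372, -2226749,
  126429, 115493, -15057, -4457, 864, 117, -42], [339086, 1276993, -36407, -63338, 12919, 2524,
  -1037, -64, 55]], 34743000000, 8421393, 19040555, 54804004⟩,
  ⟨[[-20099862671, 2544584011, 1156345909, -211322061, 29399447, 6789084, -2223068, -49530, 55186,
  -5685, -513, 271, -14, -6, 1], [2371976868, 1038953074, -148679504, -1496910, 2617430, -1895141,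
  -38200, 62800, -2921, -741, 227, -14, -7], [64147187, 46932764, -1857812, 106316, 91683, -85260,
  -3093, 2039, -184, 14, 12], [2465173, 803244, -122614, 7630, -3834, -2684, 238, 35, -9]],
  34743000000, 19040667, 25317462, 72870685⟩,
  ⟨[[-11525706580, 5712271476, 643148051, -18785857, -9630633, -9459333, 203228, 287036, 8129,
  -2151, -765, -81, 24, 3, 0], [3829074248, 375408871, -220153042, -34109178, -5342911, 1171834,
  386077, -11681, -8338, -762, 46, 37, 2], [150201297, 37089466, -5403582, -2089299, -458334,
  26447, 22837, 1717, -322, -111, -8], [3513956, 125736, -306395, -74935, -7076, 3286, 814, 9,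
  -24]], 34001000000, 25317623, 32660280, 96056822⟩,
  ⟨[[1914245301, 7161350079, -220307623, -289903463, -21302512, 10738278, 1605830, -344144, -62760,
  7008, 2041, -82, -57, 0, 1], [3399231318, -932486131, -391371269, 8446279, 15965373, 925366,
  -598605, -60916, 15705, 2537, -266, -79, 2], [181104829, -17583116, -21274613, -1232075, 893409,
  121735, -34705, -7116, 943, 323, -14], [1977081, -1836833, -523134, 72653, 38008, -1232, -2175,
  -93, 95]], 34001000000, 32660674, 74698485, 219694965⟩,
  ⟨[[13087224114, 3092943890, -1520174574, -19030680, 61971964, -3455658, -2392533, 221273, 70228,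
  -9434, -1633, 322, 33, -9, -1], [280200034, -1934108429, -33159195, 78355003, -5996203, -2967795,
  418989, 102221, -16385, -2592, 557, 58, -17], [66411272, -87474525, -7878840, 4027782, -201394,
  -195526, 24554, 7153, -1346, -168, 62], [-2764240, -2296288, 317667, 96018, -33130, -1609, 2252,
  -56, -101]], 34001000000, 74698743, 175128939, 515069966⟩,
  ⟨[[13808533027, -1823952590, -775624109, 144281123, -21080761, -4407603, 1524462, 24789, -36121,
  3936, 277, -176, 10, 4, -1], [-3249728317, -1449228440, 190438318, 1694721, -2961024, 2582229,
  42775, -80512, 3517, 749, -264, 22, 8], [-115194814, -86300793, 3961284, 35924, -177835, 144930,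
  6579, -3656, 225, -9, -17], [-5781062, -724699, 359843, -5679, 16571, 4456, -815, -50, 11]],
  34001000000, 175129207, 231017828, 679444217⟩]

set_option maxRecDepth 100000 in
theorem checkChain_solitonPieces : checkChain solitonPieces 0 initialEndpoint = true := by
  decide +kernel

theorem exists_bounded_tendsto_traj : ∃ s : ℝ, s ≠ 0 ∧
    (∀ x, |(traj s x).1| ≤ 2 ∧ |(traj s x).2| ≤ 2) ∧ Tendsto (traj s) atTop (𝓝 (0, 0)) := by
  have hnear (ς : ℝ) (hς : |ς| ≤ 1) := near_lastEndpoint hς solitonPieces checkChain_solitonPieces (near_initialEndpoint ς)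
  have hlen : ((0 + solitonPieces.length : ℕ) : ℝ) = 24 := by norm_num [solitonPieces]
  have hlast : lastEndpoint solitonPieces initialEndpoint = finalEndpoint := rfl
  simp only [hlen, hlast] at hnear
  have hb (ς : ℝ) (hς : |ς| ≤ 1) := coord_bounds_of_near hς (hnear ς hς).1
  have hparam : ∀ s ∈ Icc (0.712137 + 0.012 * (-1) : ℝ) (0.712137 + 0.012 * 1),
      ∃ ς : ℝ, |ς| ≤ 1 ∧ s = 0.712137 + 0.012 * ς := fun s hs =>
    ⟨(s - 0.712137) / 0.012, by
      rw [abs_le, le_div_iff₀ (by norm_num), div_le_iff₀ (by norm_num)]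
      constructor <;> linarith [hs.1, hs.2], by ring⟩
  obtain ⟨s, hs, hcone⟩ := exists_mem_cone (T := π / 4 * 24) (by norm_num) (by positivity)
    (by norm_num)
    (fun s hs => by
      obtain ⟨ς, hς, rfl⟩ := hparam s hs
      exact ⟨(hb ς hς).1, (hb ς hς).2.1⟩)
    ((hb (-1) (by simp)).2.2.1 rfl) ((hb 1 (by simp)).2.2.2 rfl)
  have hs0 : s ≠ 0 := by linarith [hs.1]
  obtain ⟨ς, hς, rfl⟩ := hparam s hs
  obtain ⟨h1, h2⟩ := tendsto_traj_of_mem_cone (hb ς hς).2.1 hcone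
  have hnonneg : ∀ x, 0 ≤ x → |(traj (0.712137 + 0.012 * ς) x).1| ≤ 2 ∧
      |(traj (0.712137 + 0.012 * ς) x).2| ≤ 2 := fun x hx => by
    rcases lt_or_ge x (π / 4 * 24) with h | h
    · obtain ⟨h3, h4⟩ := (hnear ς hς).2 x ⟨by simpa using hx, h⟩
      exact ⟨h3.trans (by norm_num), h4⟩
    · exact h1 x h
  refine ⟨_, hs0, fun x => ?_, h2⟩
  rcases le_total 0 x with h | h
  · exact hnonneg x h
  · have := hnonneg (-x) (by linarith)
    rwa [traj_neg, abs_neg] at this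

end GrossPitaevskii

/-- **Theorem 1.1 of the paper.**  The time-independent Gross–Pitaevskii equation
`u'' + (a − b cos(2x)) u − c u³ = 0` with parameters `a = 1.1025`, `b = 0.55125`,
`c = −0.826875` has a soliton solution `u : ℝ → ℝ` (a `C²` solution on all of `ℝ` with
`(u(x), u'(x)) → (0,0)` as `x → ±∞`) that is even and not identically zero. -/
theorem gross_pitaevskii_soliton_main :
    ∃ u : ℝ → ℝ,
      ContDiff ℝ 2 u ∧
      (∀ x : ℝ,
        deriv (deriv u) x + ((1.1025 : ℝ) - (0.55125 : ℝ) * Real.cos (2 * x)) * u x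
          - (-0.826875 : ℝ) * (u x) ^ 3 = 0) ∧
      Tendsto (fun x : ℝ => (u x, deriv u x)) atTop (nhds (0, 0)) ∧
      Tendsto (fun x : ℝ => (u x, deriv u x)) atBot (nhds (0, 0)) ∧
      (∀ x : ℝ, u (-x) = u x) ∧
      u ≠ 0 := by
  open GrossPitaevskii in
  obtain ⟨s, hs, hb, hlim⟩ := exists_bounded_tendsto_traj
  have hu (x : ℝ) : HasDerivAt (fun t => (traj s t).1) (traj s x).2 x := by
    have := hasDerivAt_traj_fst s x
    rwa [clip_of_abs_le (hb x).2] at this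
  have hv (x : ℝ) := hasDerivAt_traj_snd s x
  simp only [clip_of_abs_le (hb _).1] at hv
  have hdu : deriv (fun t => (traj s t).1) = fun t => (traj s t).2 := funext fun x => (hu x).deriv
  have hdv := funext fun x => (hv x).deriv
  have hcont := continuous_traj s
  refine ⟨fun t => (traj s t).1, ?_, fun x => ?_, ?_, ?_, fun x => ?_, fun h => hs ?_⟩
  · rw [show (2 : WithTop ℕ∞) = 1 + 1 by norm_num, contDiff_succ_iff_deriv]
    refine ⟨fun x => (hu x).differentiableAt, by simp, ?_⟩
    rw [hdu, contDiff_one_iff_deriv]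
    refine ⟨fun x => (hv x).differentiableAt, ?_⟩
    rw [hdv]
    fun_prop
  · rw [hdu, (hv x).deriv]
    ring
  · rw [hdu]
    exact hlim
  · rw [hdu]
    have h := hlim.comp tendsto_neg_atBot_atTop
    have h' := h.fst_nhds.prodMk_nhds h.snd_nhds.neg
    simpa [Function.comp_def, traj_neg] using h'
  · simp only [traj_neg]
  · simpa [traj_zero] using congrFun h 0
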